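/- For every positive integer w, d(w,2) ≤ D_w, where (D_w)_{w≥0} is determined by D_0 = 1, D_1 = 1 and D_w = D_{w−1} + D_{w−2} for w ≥ 2 (i.e., Σ_{w≥0} D_w t^w = (1 − t − t²)^{-1}). Here d(w,2) is the dimension of the ℚ-span of alternating multiple zeta values of weight w. -/

import Mathlib

open Filter Topology

/-- `mpvPartial l m` is the finite iterated sum
`∑_{m > k₁ > k₂ > ⋯ > kₙ > 0} ∏ⱼ ζⱼ^{kⱼ} / kⱼ^{sⱼ}`, where `l = [(s₁,ζ₁),…,(sₙ,ζₙ)]`,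
i.e. the partial sum (in the outermost variable `k₁`) of the multiple
polylogarithm series; the inner sums are finite. -/
noncomputable def mpvPartial : List (ℕ × ℂ) → ℕ → ℂ
  | [], _ => 1
  | (s, z) :: t, m => ∑ k ∈ Finset.Ico 1 m, z ^ k / (k : ℂ) ^ s * mpvPartial t k

/-- The multiple polylogarithm value
`Li_{s₁,…,sₙ}(ζ₁,…,ζₙ) = ∑_{k₁>⋯>kₙ>0} ζ₁^{k₁}⋯ζₙ^{kₙ} / (k₁^{s₁}⋯kₙ^{sₙ})`,
encoded by the list `l = [(s₁,ζ₁),…,(sₙ,ζₙ)]`: the limit of the sequence of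
partial sums in the outermost summation variable. -/
noncomputable def Li (l : List (ℕ × ℂ)) : ℂ :=
  limUnder atTop (mpvPartial l)

/-- The set of all multiple polylogarithm values of weight `w` and level `N`:
values `Li_{s₁,…,sₙ}(ζ₁,…,ζₙ)` with all `sⱼ ≥ 1`, all `ζⱼ` being `N`-th roots of
unity, total weight `s₁+⋯+sₙ = w`, and `(s₁,ζ₁) ≠ (1,1)`. -/
def MPVset (w N : ℕ) : Set ℂ :=
  {x | ∃ l : List (ℕ × ℂ),
    (∀ q ∈ l, 0 < q.1 ∧ q.2 ^ N = 1) ∧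
    (l.map Prod.fst).sum = w ∧
    l.head? ≠ some (1, 1) ∧
    x = Li l}

/-- `MPV w N` is the `ℚ`-vector subspace of `ℂ` spanned by all multiple
polylogarithm values of weight `w` and level `N`. -/
noncomputable def MPV (w N : ℕ) : Submodule ℚ ℂ :=
  Submodule.span ℚ (MPVset w N)

namespace EulerSum
open Set MeasureTheory

/-- A majorant for iterated integrals. -/
noncomputable def beta (t : ℝ) : ℝ := √(t / (1 - t))

theorem beta_nonneg (t : ℝ) : 0 ≤ beta t := Real.sqrt_nonneg _

theorem continuousAt_beta {t : ℝ} (ht : t < 1) : ContinuousAt beta t := by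
  unfold beta
  have : 1 - t ≠ 0 := by linarith [ht]
  fun_prop (disch := assumption)

theorem hasDerivAt_beta {t : ℝ} (ht : t ∈ Ioo (0:ℝ) 1) :
    HasDerivAt (fun t => 2 * beta t) (beta t / (t * (1 - t))) t := by
  obtain ⟨h0, h1⟩ := ht
  have h1' : 0 < 1 - t := by linarith
  have hq : 0 < t / (1 - t) := div_pos h0 h1'
  have h := ((((hasDerivAt_id t).div ((hasDerivAt_const t (1:ℝ)).sub (hasDerivAt_id t))
    h1'.ne').sqrt hq.ne').const_mul 2)
  refine HasDerivAt.congr_deriv (f := fun t => 2 * beta t) h ?_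
  change 2 * ((1 * (1 - t) - t * (0 - 1)) / (1 - t) ^ 2 / (2 * √(t / (1 - t)))) = √(t / (1 - t)) / (t * (1 - t))
  have hs : 0 < √(t / (1 - t)) := Real.sqrt_pos.2 hq
  have hs2 : √(t / (1 - t)) ^ 2 = t / (1 - t) := Real.sq_sqrt hq.le
  have e : √(t / (1 - t)) ^ 2 * (1 - t) = t := by rw [hs2]; field_simp
  generalize √(t / (1 - t)) = r at hs e
  field_simp
  linear_combination -e

theorem integrable_beta {s : ℝ} (hs : s ∈ Ioo (0:ℝ) 1) :
    IntervalIntegrable (fun t => beta t / (t * (1 - t))) volume 0 s ∧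
    ∫ t in (0:ℝ)..s, beta t / (t * (1 - t)) = 2 * beta s := by
  have hc : ContinuousOn (fun t => 2 * beta t) (Icc 0 s) := fun t ht =>
    (continuousAt_const.mul (continuousAt_beta (ht.2.trans_lt hs.2))).continuousWithinAt
  have hd : ∀ t ∈ Ioo 0 s, HasDerivAt (fun t => 2 * beta t) (beta t / (t * (1 - t))) t :=
    fun t ht => hasDerivAt_beta ⟨ht.1, ht.2.trans hs.2⟩
  have hn : ∀ t ∈ Ioo 0 s, 0 ≤ beta t / (t * (1 - t)) := fun t ht =>
    div_nonneg (beta_nonneg t) (mul_nonneg ht.1.le (by linarith [ht.2, hs.2]))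
  have hi := intervalIntegral.integrableOn_deriv_of_nonneg hc hd hn
  have hI : IntervalIntegrable (fun t => beta t / (t * (1 - t))) volume 0 s :=
    (intervalIntegrable_iff_integrableOn_Ioc_of_le hs.1.le).2 hi
  refine ⟨hI, ?_⟩
  rw [intervalIntegral.integral_eq_sub_of_hasDerivAt_of_le hs.1.le hc hd hI]
  simp [beta]

theorem integrable_beta_one : IntervalIntegrable (fun t => beta t / t) volume 0 1 := by
  have hc : ContinuousOn (fun t => 2 * √t - 2 * √(1 - t)) (Icc 0 1) := by fun_prop
  have hd : ∀ t ∈ Ioo (0:ℝ) 1, HasDerivAt (fun t => 2 * √t - 2 * √(1 - t))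
      (1 / √t + 1 / √(1 - t)) t := by
    intro t ht
    have h1 := (Real.hasDerivAt_sqrt ht.1.ne').const_mul 2
    have h2 := (((hasDerivAt_const t (1:ℝ)).sub (hasDerivAt_id t)).sqrt
      (by simp; linarith [ht.2])).const_mul 2
    refine HasDerivAt.congr_deriv (f := fun t => 2 * √t - 2 * √(1 - t)) (h1.sub h2) ?_
    have := Real.sqrt_pos.2 ht.1
    have := Real.sqrt_pos.2 (sub_pos.2 ht.2)
    change 2 * (1 / (2 * √t)) - 2 * ((0 - 1) / (2 * √(1 - t))) = _
    field_simp
    ring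
  have hi := intervalIntegral.integrableOn_deriv_of_nonneg hc hd
    (fun t ht => by positivity)
  have hI : IntervalIntegrable (fun t => 1 / √t + 1 / √(1 - t)) volume 0 1 :=
    (intervalIntegrable_iff_integrableOn_Ioc_of_le zero_le_one).2 hi
  have hcont : ContinuousOn (fun t => beta t / t) (Ioo 0 1) := fun t ht =>
    ((continuousAt_beta ht.2).div continuousAt_id ht.1.ne').continuousWithinAt
  rw [intervalIntegrable_iff_integrableOn_Ioo_of_le zero_le_one] at hI ⊢
  refine hI.mono' (hcont.aestronglyMeasurable measurableSet_Ioo) ?_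
  refine (ae_restrict_iff' measurableSet_Ioo).2 (Eventually.of_forall fun t ht => ?_)
  have h0 := Real.sqrt_pos.2 ht.1
  have h1 := Real.sqrt_pos.2 (sub_pos.2 ht.2)
  have e0 : √t ^ 2 = t := Real.sq_sqrt ht.1.le
  have e1 : √(1 - t) ^ 2 = 1 - t := Real.sq_sqrt (sub_pos.2 ht.2).le
  rw [Real.norm_of_nonneg (div_nonneg (beta_nonneg t) ht.1.le), beta, Real.sqrt_div ht.1.le,
    div_add_div _ _ h0.ne' h1.ne', div_div, div_le_div_iff₀ (mul_pos h1 ht.1) (by positivity)]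
  have h01 : 1 ≤ √t + √(1 - t) := by nlinarith
  have : √t * (√t * √(1 - t)) = t * √(1-t) := by rw [← e0]; simp [Real.sqrt_sq h0.le]; ring
  rw [this]
  nlinarith [mul_pos h1 ht.1]

theorem comparison {g : ℝ → ℝ} {A : ℝ} (hg : ContinuousOn g (Ioo 0 1))
    (hA : ∀ u ∈ Ioo (0:ℝ) 1, |g u| ≤ A * (beta u / (u * (1 - u)))) {s : ℝ}
    (hs : s ∈ Ioo (0:ℝ) 1) :
    IntervalIntegrable g volume 0 s ∧ HasDerivAt (fun t => ∫ u in (0:ℝ)..t, g u) (g s) s ∧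
    |∫ u in (0:ℝ)..s, g u| ≤ 2 * A * beta s := by
  have hI : IntervalIntegrable g volume 0 s := by
    have h := (integrable_beta hs).1.const_mul A
    rw [intervalIntegrable_iff_integrableOn_Ioo_of_le hs.1.le] at h ⊢
    refine h.mono' ((hg.mono (Ioo_subset_Ioo_right hs.2.le)).aestronglyMeasurable
      measurableSet_Ioo) ?_
    exact (ae_restrict_iff' measurableSet_Ioo).2
      (Eventually.of_forall fun t ht => hA t ⟨ht.1, ht.2.trans hs.2⟩)
  refine ⟨hI, ?_, ?_⟩
  · exact intervalIntegral.integral_hasDerivAt_right hI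
      (hg.stronglyMeasurableAtFilter isOpen_Ioo s hs) (hg.continuousAt (isOpen_Ioo.mem_nhds hs))
  · calc |∫ u in (0:ℝ)..s, g u| ≤ ∫ u in (0:ℝ)..s, A * (beta u / (u * (1 - u))) := by
          have h := (integrable_beta hs).1.const_mul A
          rw [← Real.norm_eq_abs]
          refine intervalIntegral.norm_integral_le_of_norm_le hs.1.le ?_ h
          exact Eventually.of_forall fun t ht =>
            hA t ⟨ht.1, ht.2.trans_lt hs.2⟩
      _ = 2 * A * beta s := by
          rw [intervalIntegral.integral_const_mul, (integrable_beta hs).2]; ring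

theorem comparison_one {g : ℝ → ℝ} {A : ℝ} (hg : ContinuousOn g (Ioo 0 1))
    (hA : ∀ u ∈ Ioo (0:ℝ) 1, |g u| ≤ A * (beta u / u)) :
    IntervalIntegrable g volume 0 1 := by
  have h := integrable_beta_one.const_mul A
  rw [intervalIntegrable_iff_integrableOn_Ioo_of_le zero_le_one] at h ⊢
  refine h.mono' (hg.aestronglyMeasurable measurableSet_Ioo) ?_
  exact (ae_restrict_iff' measurableSet_Ioo).2 (Eventually.of_forall fun t ht => hA t ht)

/-- Letters: `o`, `i` are the singular points `0`, `1`; `m`, `M` are `-1/z`, `-z`. -/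
inductive Lt | o | i | m | M

open Lt

instance : DecidableEq Lt := fun x y => by
  cases x <;> cases y <;> first | exact isTrue rfl | exact isFalse Lt.noConfusion

/-- The singular point of a letter. -/
noncomputable def pt : Lt → ℝ → ℝ
  | o, _ => 0
  | i, _ => 1
  | m, z => -z⁻¹
  | M, z => -z

/-- The `z`-derivative of the singular point. -/
noncomputable def dpt : Lt → ℝ → ℝ
  | o, _ => 0
  | i, _ => 0
  | m, z => (z ^ 2)⁻¹
  | M, _ => -1

noncomputable def om (x : Lt) (z t : ℝ) : ℝ := (t - pt x z)⁻¹

/-- The `z`-derivative of `om`. -/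
noncomputable def dom (x : Lt) (z t : ℝ) : ℝ := dpt x z / (t - pt x z) ^ 2

abbrev IsLog (W : List Lt) : Prop := ∀ y ∈ W, y = o

theorem isLog_nil : IsLog [] := by simp [IsLog]

theorem isLog_cons {x : Lt} {W : List Lt} : IsLog (x :: W) ↔ x = o ∧ IsLog W := by
  simp [IsLog]

open Nat in
/-- Iterated integrals, outermost letter first, regularised by powers of `log` on words in `o`. -/
noncomputable def F : List Lt → ℝ → ℝ → ℝ
  | [], _, _ => 1
  | x :: W, z, t => if IsLog (x :: W) then Real.log t ^ (W.length + 1) / (W.length + 1)! else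
      ∫ u in (0:ℝ)..t, om x z u * F W z u

/-- Size of a letter form. -/
noncomputable def nl : Lt → ℝ → ℝ
  | o, _ => 1
  | i, _ => 1
  | m, z => z
  | M, z => z ^ (-(3/4) : ℝ)

noncomputable def nw (W : List Lt) (z : ℝ) : ℝ := (W.map fun x => nl x z).prod

theorem nl_pos (x : Lt) {z : ℝ} (hz : 0 < z) : 0 < nl x z := by
  cases x <;> simp [nl] <;> positivity

theorem nw_pos (W : List Lt) {z : ℝ} (hz : 0 < z) : 0 < nw W z := by
  induction W with
  | nil => simp [nw]
  | cons x W ih => simpa [nw] using mul_pos (nl_pos x hz) ih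

theorem nw_cons (x : Lt) (W : List Lt) (z : ℝ) : nw (x :: W) z = nl x z * nw W z := by simp [nw]

theorem sub_pt_pos {x : Lt} (hx : x ≠ i) {z t : ℝ} (hz : 0 < z) (ht : 0 < t) :
    0 < t - pt x z := by
  cases x <;> simp_all [pt] <;> positivity

theorem sub_pt_ne {x : Lt} {z t : ℝ} (hz : 0 < z) (ht : t ∈ Ioo (0:ℝ) 1) : t - pt x z ≠ 0 := by
  by_cases hx : x = i
  · subst hx; simp [pt]; linarith [ht.2]
  · exact (sub_pt_pos hx hz ht.1).ne'

theorem om_pos {x : Lt} (hx : x ≠ i) {z t : ℝ} (hz : 0 < z) (ht : 0 < t) : 0 < om x z t :=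
  inv_pos.2 (sub_pt_pos hx hz ht)

theorem om_le_div {x : Lt} (hx : x ≠ i) {z t : ℝ} (hz : 0 < z) (ht : t ∈ Ioc (0:ℝ) 1) :
    om x z t ≤ nl x z / t := by
  have h := sub_pt_pos hx hz ht.1
  obtain ⟨h0, h1⟩ := ht
  rw [om, inv_eq_one_div, div_le_div_iff₀ h h0]
  cases x
  · simp [pt, nl]
  · simp at hx
  · simp only [pt, nl]
    have : z * z⁻¹ = 1 := mul_inv_cancel₀ hz.ne'
    nlinarith [mul_pos hz h0]
  · simp only [pt, nl, Real.rpow_neg hz.le]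
    have h3 : 0 < z ^ (3/4 : ℝ) := by positivity
    rw [inv_mul_eq_div, le_div_iff₀ h3]
    rcases le_total z 1 with hz1 | hz1
    · have : z ^ (3/4 : ℝ) ≤ 1 := Real.rpow_le_one hz.le hz1 (by norm_num)
      nlinarith
    · have : z ^ (3/4 : ℝ) ≤ z := by
        conv_rhs => rw [← Real.rpow_one z]
        exact Real.rpow_le_rpow_of_exponent_le hz1 (by norm_num)
      nlinarith

theorem om_le_rpow {x : Lt} (hx : x ≠ i) (hx' : x ≠ o) {z t : ℝ} (hz : 0 < z)
    (ht : t ∈ Ioc (0:ℝ) 1) : om x z t ≤ nl x z * t ^ (-(1/4) : ℝ) := by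
  have h := sub_pt_pos hx hz ht.1
  obtain ⟨h0, h1⟩ := ht
  rw [om, inv_le_iff_one_le_mul₀ h]
  cases x
  · simp at hx'
  · simp at hx
  · simp only [pt, nl]
    have : z * z⁻¹ = 1 := mul_inv_cancel₀ hz.ne'
    have h2 : 1 ≤ t ^ (-(1/4) : ℝ) := Real.one_le_rpow_of_pos_of_le_one_of_nonpos h0 h1 (by norm_num)
    have h3 : 1 ≤ z * (t - -z⁻¹) := by nlinarith [mul_pos hz h0]
    nlinarith
  · simp only [pt, nl, Real.rpow_neg hz.le, Real.rpow_neg h0.le]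
    have h3 : 0 < z ^ (3/4 : ℝ) := by positivity
    have h4 : 0 < t ^ (1/4 : ℝ) := by positivity
    have := Real.geom_mean_le_arith_mean2_weighted (w₁ := 3/4) (w₂ := 1/4) (by norm_num)
      (by norm_num) hz.le h0.le (by norm_num)
    rw [← mul_inv, inv_mul_eq_div, one_le_div (by positivity)]
    nlinarith

theorem rpow_quarter_le {t : ℝ} (ht : t ∈ Ioo (0:ℝ) 1) :
    t ^ (-(1/4) : ℝ) * t ^ (-(1/4) : ℝ) ≤ beta t / t := by
  obtain ⟨h0, h1⟩ := ht
  rw [← Real.rpow_add h0, le_div_iff₀ h0, beta, Real.sqrt_eq_rpow,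
    Real.div_rpow h0.le (by linarith)]
  have e : t ^ (-(1/4) + -(1/4) : ℝ) * t = t ^ (1/2 : ℝ) := by
    nth_rewrite 2 [← Real.rpow_one t]
    rw [← Real.rpow_add h0]; norm_num
  rw [e]
  have : (1 - t) ^ (1/2 : ℝ) ≤ 1 := Real.rpow_le_one (by linarith) (by linarith) (by norm_num)
  rw [le_div_iff₀ (Real.rpow_pos_of_pos (by linarith) _)]
  have := Real.rpow_pos_of_pos h0 (1/2)
  nlinarith

theorem one_le_rpow_quarter {t : ℝ} (ht : t ∈ Ioo (0:ℝ) 1) : 1 ≤ t ^ (-(1/4) : ℝ) :=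
  Real.one_le_rpow_of_pos_of_le_one_of_nonpos ht.1 ht.2.le (by norm_num)

theorem beta_div_le {t : ℝ} (ht : t ∈ Ioo (0:ℝ) 1) : beta t / t ≤ beta t / (t * (1 - t)) := by
  have h2 : 0 < 1 - t := by linarith [ht.2]
  have := beta_nonneg t
  have := ht.1
  apply div_le_div_of_nonneg_left (by positivity) (by positivity)
  nlinarith

theorem abs_om_le {x : Lt} {z t : ℝ} (hz : 0 < z) (ht : t ∈ Ioo (0:ℝ) 1) :
    |om x z t| ≤ nl x z / (t * (1 - t)) := by
  have h2 : 0 < 1 - t := by linarith [ht.2]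
  have := ht.1
  by_cases hx : x = i
  · subst hx
    rw [om, pt, abs_inv, abs_of_neg (by linarith), nl, inv_eq_one_div]
    apply div_le_div_of_nonneg_left (by positivity) (by positivity)
    nlinarith
  · rw [abs_of_pos (om_pos hx hz ht.1)]
    refine (om_le_div hx hz ⟨ht.1, ht.2.le⟩).trans ?_
    apply div_le_div_of_nonneg_left (nl_pos x hz).le (by positivity)
    nlinarith

theorem abs_om_le' {x : Lt} (hx : x ≠ o) {z t : ℝ} (hz : 0 < z) (ht : t ∈ Ioo (0:ℝ) 1) :
    |om x z t| ≤ nl x z * t ^ (-(1/4) : ℝ) / (1 - t) := by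
  have h2 : 0 < 1 - t := by linarith [ht.2]
  have h0 := one_le_rpow_quarter ht
  by_cases hx' : x = i
  · subst hx'
    rw [om, pt, abs_inv, abs_of_neg (by linarith), nl, inv_eq_one_div, neg_sub, one_mul]
    gcongr
  · rw [abs_of_pos (om_pos hx' hz ht.1)]
    refine (om_le_rpow hx' hx hz ⟨ht.1, ht.2.le⟩).trans ?_
    rw [le_div_iff₀ h2]
    have := mul_nonneg (nl_pos x hz).le (zero_le_one.trans h0)
    nlinarith [ht.1]

theorem continuousOn_om (x : Lt) {z : ℝ} (hz : 0 < z) : ContinuousOn (om x z) (Ioo 0 1) := by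
  unfold om
  exact ContinuousOn.inv₀ (by fun_prop) fun t ht => sub_pt_ne hz ht

theorem F_isLog {W : List Lt} (h : IsLog W) (z t : ℝ) :
    F W z t = Real.log t ^ W.length / (W.length).factorial := by
  cases W with
  | nil => simp [F]
  | cons x W => rw [F, if_pos h]; simp

theorem F_cons {x : Lt} {W : List Lt} (h : ¬ IsLog (x :: W)) (z t : ℝ) :
    F (x :: W) z t = ∫ u in (0:ℝ)..t, om x z u * F W z u := by
  rw [F, if_neg h]

theorem abs_F_isLog_le {W : List Lt} (h : IsLog W) (z : ℝ) {t : ℝ} (ht : t ∈ Ioo (0:ℝ) 1) :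
    |F W z t| ≤ 4 ^ W.length * t ^ (-(1/4) : ℝ) := by
  have hl := Real.log_neg ht.1 ht.2
  rw [F_isLog h, abs_div, abs_pow, abs_of_neg hl, Nat.abs_cast]
  have := Real.pow_div_factorial_le_exp (-Real.log t / 4) (by linarith) W.length
  rw [Real.rpow_def_of_pos ht.1]
  have e : Real.log t * -(1/4) = - Real.log t / 4 := by ring
  rw [e]
  rw [div_pow, div_right_comm, div_le_iff₀ (by positivity)] at this
  linarith

theorem abs_integrand_le {x : Lt} {V : List Lt} (h : ¬ IsLog (x :: V)) {z : ℝ} (hz : 0 < z)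
    (hV : ¬ IsLog V → ∀ t ∈ Ioo (0:ℝ) 1, |F V z t| ≤ 4 ^ V.length * nw V z * beta t)
    {t : ℝ} (ht : t ∈ Ioo (0:ℝ) 1) :
    |om x z t * F V z t| ≤ 4 ^ V.length * nw (x :: V) z * (beta t / (t * (1 - t))) ∧
    (x ≠ i → |om x z t * F V z t| ≤ 4 ^ V.length * nw (x :: V) z * (beta t / t)) := by
  have h2 : 0 < 1 - t := by linarith [ht.2]
  have h0 := ht.1
  rw [abs_mul, nw_cons]
  have hnl := nl_pos x hz
  have hnw := nw_pos V hz
  have hb := beta_nonneg t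
  by_cases hp : IsLog V
  · have hx : x ≠ o := by
      rintro rfl
      exact h (isLog_cons.2 ⟨rfl, hp⟩)
    have hF := abs_F_isLog_le hp z ht
    have hq := rpow_quarter_le ht
    have hq0 := one_le_rpow_quarter ht
    have hN : nw V z = 1 := by
      unfold nw
      apply List.prod_eq_one
      intro a ha
      obtain ⟨y, hy, rfl⟩ := List.mem_map.1 ha
      simp [hp y hy, nl]
    rw [hN, mul_one]
    constructor
    · calc |om x z t| * |F V z t| ≤ (nl x z * t ^ (-(1/4) : ℝ) / (1 - t)) *
            (4 ^ V.length * t ^ (-(1/4) : ℝ)) := by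
            gcongr; exact abs_om_le' hx hz ht
        _ = 4 ^ V.length * nl x z * ((t ^ (-(1/4) : ℝ) * t ^ (-(1/4) : ℝ)) / (1 - t)) := by ring
        _ ≤ 4 ^ V.length * nl x z * ((beta t / t) / (1 - t)) := by gcongr
        _ = _ := by rw [div_div]
    · intro hi
      calc |om x z t| * |F V z t| ≤ (nl x z * t ^ (-(1/4) : ℝ)) *
            (4 ^ V.length * t ^ (-(1/4) : ℝ)) := by
            gcongr
            rw [abs_of_pos (om_pos hi hz h0)]; exact om_le_rpow hi hx hz ⟨h0, ht.2.le⟩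
        _ = 4 ^ V.length * nl x z * ((t ^ (-(1/4) : ℝ) * t ^ (-(1/4) : ℝ))) := by ring
        _ ≤ _ := by gcongr
  · have hF := hV hp t ht
    constructor
    · calc |om x z t| * |F V z t| ≤ (nl x z / (t * (1 - t))) * (4 ^ V.length * nw V z * beta t) := by
            gcongr; exact abs_om_le hz ht
        _ = _ := by ring
    · intro hi
      calc |om x z t| * |F V z t| ≤ (nl x z / t) * (4 ^ V.length * nw V z * beta t) := by
            gcongr
            rw [abs_of_pos (om_pos hi hz h0)]; exact om_le_div hi hz ⟨h0, ht.2.le⟩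
        _ = _ := by ring

theorem F_main (W : List Lt) {z : ℝ} (hz : 0 < z) :
    ContinuousOn (F W z) (Ioo 0 1) ∧
    (¬ IsLog W → ∀ t ∈ Ioo (0:ℝ) 1, |F W z t| ≤ 4 ^ W.length * nw W z * beta t) := by
  induction W with
  | nil => exact ⟨by simp only [F]; fun_prop, fun h => absurd isLog_nil h⟩
  | cons x V ih =>
    by_cases h : IsLog (x :: V)
    · refine ⟨?_, fun h' => absurd h h'⟩
      have : F (x :: V) z = fun t => Real.log t ^ (x :: V).length / ((x :: V).length).factorial :=
        funext fun t => F_isLog h z t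
      rw [this]
      exact ((Real.continuousOn_log.mono fun t ht => ht.1.ne').pow _).div_const _
    · have hc : ContinuousOn (fun u => om x z u * F V z u) (Ioo 0 1) :=
        (continuousOn_om x hz).mul ih.1
      have key := fun {s} hs => comparison (s := s) hc
        (fun u hu => (abs_integrand_le h hz ih.2 hu).1) hs
      have e : F (x :: V) z = fun t => ∫ u in (0:ℝ)..t, om x z u * F V z u :=
        funext fun t => F_cons h z t
      rw [e]
      refine ⟨fun t ht => (key ht).2.1.continuousAt.continuousWithinAt, fun _ t ht => ?_⟩
      refine (key ht).2.2.trans ?_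
      simp only [List.length_cons, pow_succ]
      have := nw_pos (x :: V) hz
      have := beta_nonneg t
      have : 0 ≤ (4:ℝ) ^ V.length * nw (x :: V) z * beta t := by positivity
      linarith

theorem continuousOn_F (W : List Lt) {z : ℝ} (hz : 0 < z) : ContinuousOn (F W z) (Ioo 0 1) :=
  (F_main W hz).1

theorem abs_F_le {W : List Lt} (h : ¬ IsLog W) {z : ℝ} (hz : 0 < z) {t : ℝ}
    (ht : t ∈ Ioo (0:ℝ) 1) : |F W z t| ≤ 4 ^ W.length * nw W z * beta t :=
  (F_main W hz).2 h t ht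

theorem continuousOn_integrand (x : Lt) (V : List Lt) {z : ℝ} (hz : 0 < z) :
    ContinuousOn (fun u => om x z u * F V z u) (Ioo 0 1) :=
  (continuousOn_om x hz).mul (continuousOn_F V hz)

theorem hasDerivAt_F (x : Lt) (V : List Lt) {z : ℝ} (hz : 0 < z) {t : ℝ} (ht : t ∈ Ioo (0:ℝ) 1) :
    HasDerivAt (F (x :: V) z) (om x z t * F V z t) t := by
  by_cases h : IsLog (x :: V)
  · have e : F (x :: V) z = fun t => Real.log t ^ (V.length + 1) / ((V.length + 1).factorial : ℝ) :=
      funext fun t => F_isLog h z t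
    have hx : x = o := h x (by simp)
    rw [e, F_isLog (fun y hy => h y (by simp [hy])), hx]
    refine HasDerivAt.congr_deriv (((Real.hasDerivAt_log ht.1.ne').pow (V.length + 1)).div_const _) ?_
    rw [Nat.factorial_succ]
    have := Nat.factorial_ne_zero V.length
    simp only [om, pt, sub_zero, Nat.add_sub_cancel]
    push_cast
    field_simp
  · have e : F (x :: V) z = fun t => ∫ u in (0:ℝ)..t, om x z u * F V z u :=
      funext fun t => F_cons h z t
    rw [e]
    exact (comparison (continuousOn_integrand x V hz)
        (fun u hu => (abs_integrand_le h hz (F_main V hz).2 hu).1) ht).2.1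

theorem integrable_integrand {x : Lt} {V : List Lt} (h : ¬ IsLog (x :: V)) {z : ℝ} (hz : 0 < z)
    {t : ℝ} (ht : t ∈ Ioc (0:ℝ) 1) (hx : t = 1 → x ≠ i) :
    IntervalIntegrable (fun u => om x z u * F V z u) volume 0 t := by
  rcases ht.2.lt_or_eq with h1 | rfl
  · exact (comparison (continuousOn_integrand x V hz)
        (fun u hu => (abs_integrand_le h hz (F_main V hz).2 hu).1) ⟨ht.1, h1⟩).1
  · exact comparison_one (continuousOn_integrand x V hz)
        (fun u hu => (abs_integrand_le h hz (F_main V hz).2 hu).2 (hx rfl))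

theorem tendsto_F_one {W : List Lt} (hW : W.headD o ≠ i) {z : ℝ} (hz : 0 < z) :
    Tendsto (F W z) (𝓝[<] 1) (𝓝 (F W z 1)) := by
  by_cases h : IsLog W
  · have e : F W z = fun t => Real.log t ^ W.length / (W.length).factorial :=
      funext fun t => F_isLog h z t
    rw [e]
    exact ((((Real.continuousAt_log one_ne_zero).pow _).div_const _).tendsto).mono_left
      nhdsWithin_le_nhds
  · cases W with
    | nil => simp at h
    | cons x V =>
      have e : F (x :: V) z = fun t => ∫ u in (0:ℝ)..t, om x z u * F V z u :=
        funext fun t => F_cons h z t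
      rw [e]
      have hI := integrable_integrand h hz (t := 1) (by simp) fun _ => by simpa using hW
      have := intervalIntegral.continuousOn_primitive_interval'
        (hI) (by simp : (0:ℝ) ∈ uIcc 0 1) 1 (by simp)
      refine (this.tendsto).mono_left ?_
      rw [uIcc_of_le zero_le_one]
      exact nhdsWithin_le_of_mem (Icc_mem_nhdsLT zero_lt_one)

theorem tendsto_beta_zero : Tendsto beta (𝓝[>] 0) (𝓝 0) := by
  have h : ContinuousAt beta 0 := continuousAt_beta zero_lt_one
  have : beta 0 = 0 := by simp [beta]
  rw [ContinuousAt, this] at h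
  exact h.mono_left nhdsWithin_le_nhds

theorem tendsto_F_zero {W : List Lt} (h : ¬ IsLog W) {z : ℝ} (hz : 0 < z) :
    Tendsto (F W z) (𝓝[>] 0) (𝓝 0) := by
  refine squeeze_zero_norm' (a := fun t => 4 ^ W.length * nw W z * beta t) ?_ ?_
  · filter_upwards [Ioo_mem_nhdsGT zero_lt_one] with t ht using abs_F_le h hz ht
  · simpa using tendsto_beta_zero.const_mul (4 ^ W.length * nw W z)

theorem abs_F_one_le {W : List Lt} (h : ¬ IsLog W) (hW : W.headD o ≠ i) :
    ∃ C, ∀ z, 0 < z → |F W z 1| ≤ C * nw W z := by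
  cases W with
  | nil => simp at h
  | cons x V =>
    refine ⟨4 ^ V.length * ∫ u in (0:ℝ)..1, beta u / u, fun z hz => ?_⟩
    rw [F_cons h]
    have hI := integrable_beta_one.const_mul (4 ^ V.length * nw (x :: V) z)
    rw [← Real.norm_eq_abs]
    refine (intervalIntegral.norm_integral_le_of_norm_le zero_le_one ?_ hI).trans_eq ?_
    · have : ∀ᵐ t : ℝ ∂volume, t ≠ 1 := by simp [ae_iff]
      filter_upwards [this] with t ht1 ht
      exact (abs_integrand_le h hz (F_main V hz).2 ⟨ht.1, lt_of_le_of_ne ht.2 ht1⟩).2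
        (by simpa using hW)
    · rw [intervalIntegral.integral_const_mul]; ring

/-- The `z`-derivative of `F`. -/
noncomputable def dF : List Lt → ℝ → ℝ → ℝ
  | [], _, _ => 0
  | x :: W, z, t => if IsLog (x :: W) then 0 else
      ∫ u in (0:ℝ)..t, (dom x z u * F W z u + om x z u * dF W z u)

theorem dF_isLog {W : List Lt} (h : IsLog W) (z t : ℝ) : dF W z t = 0 := by
  cases W with
  | nil => rfl
  | cons x W => rw [dF, if_pos h]

theorem dF_cons {x : Lt} {W : List Lt} (h : ¬ IsLog (x :: W)) (z t : ℝ) :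
    dF (x :: W) z t = ∫ u in (0:ℝ)..t, (dom x z u * F W z u + om x z u * dF W z u) := by
  rw [dF, if_neg h]

theorem hasDerivAt_pt (x : Lt) {z : ℝ} (hz : 0 < z) : HasDerivAt (pt x) (dpt x z) z := by
  cases x
  · exact hasDerivAt_const z (0:ℝ)
  · exact hasDerivAt_const z (1:ℝ)
  · exact (hasDerivAt_inv hz.ne').neg.congr_deriv (by simp [dpt])
  · exact (hasDerivAt_id z).neg

theorem hasDerivAt_om (x : Lt) {z t : ℝ} (hz : 0 < z) (ht : t ∈ Ioo (0:ℝ) 1) :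
    HasDerivAt (fun z => om x z t) (dom x z t) z := by
  have h := ((hasDerivAt_pt x hz).const_sub t).inv (sub_pt_ne hz ht)
  exact h.congr_deriv (by simp [dom])

theorem abs_dom_le (x : Lt) {r z t : ℝ} (hr : 0 < r) (hz : r ≤ z) (ht : 0 < t) :
    |dom x z t| ≤ 1 + (r ^ 2)⁻¹ := by
  have hz0 : 0 < z := hr.trans_le hz
  cases x
  · simp only [dom, dpt, zero_div, abs_zero]; positivity
  · simp only [dom, dpt, zero_div, abs_zero]; positivity
  · have e : dom m z t = ((z * t + 1) ^ 2)⁻¹ := by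
      simp only [dom, dpt, pt]
      field_simp
      rw [sub_neg_eq_add, div_self (by positivity)]
    rw [e, abs_of_pos (by positivity)]
    have : ((z * t + 1) ^ 2)⁻¹ ≤ 1 := by
      apply inv_le_one_of_one_le₀
      nlinarith [mul_pos hz0 ht]
    have : 0 < (r ^ 2)⁻¹ := by positivity
    linarith
  · have e : dom M z t = - ((t + z) ^ 2)⁻¹ := by
      simp only [dom, dpt, pt]; ring
    rw [e, abs_neg, abs_of_pos (by positivity)]
    have : ((t + z) ^ 2)⁻¹ ≤ (r ^ 2)⁻¹ := by
      apply inv_anti₀ (by positivity)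
      gcongr; linarith
    linarith

theorem continuousOn_dom (x : Lt) {z : ℝ} (hz : 0 < z) : ContinuousOn (dom x z) (Ioo 0 1) := by
  unfold dom
  exact ContinuousOn.div (by fun_prop) (by fun_prop) fun t ht => pow_ne_zero _ (sub_pt_ne hz ht)

theorem exists_nl_le (x : Lt) {r : ℝ} (hr : 0 < r) (R : ℝ) :
    ∃ C, 0 ≤ C ∧ ∀ z ∈ Icc r R, nl x z ≤ C := by
  cases x
  · exact ⟨1, zero_le_one, fun z hz => le_rfl⟩
  · exact ⟨1, zero_le_one, fun z hz => le_rfl⟩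
  · exact ⟨|R|, abs_nonneg R, fun z hz => hz.2.trans (le_abs_self R)⟩
  · exact ⟨r ^ (-(3/4) : ℝ), by positivity, fun z hz =>
      Real.rpow_le_rpow_of_nonpos hr hz.1 (by norm_num)⟩

theorem exists_nw_le (W : List Lt) {r : ℝ} (hr : 0 < r) (R : ℝ) :
    ∃ C, 0 ≤ C ∧ ∀ z ∈ Icc r R, nw W z ≤ C := by
  induction W with
  | nil => exact ⟨1, zero_le_one, fun z hz => by simp [nw]⟩
  | cons x W ih =>
    obtain ⟨C, hC, h⟩ := ih
    obtain ⟨D, hD, h'⟩ := exists_nl_le x hr R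
    refine ⟨D * C, by positivity, fun z hz => ?_⟩
    rw [nw_cons]
    exact mul_le_mul (h' z hz) (h z hz) (nw_pos W (hr.trans_le hz.1)).le hD

/-- Uniform bounds for `F` against `beta t / t`. -/
theorem exists_F_le (V : List Lt) {r : ℝ} (hr : 0 < r) (R : ℝ) :
    ∃ C, 0 ≤ C ∧ ∀ z ∈ Icc r R, ∀ t ∈ Ioo (0:ℝ) 1, |F V z t| ≤ C * (beta t / t) := by
  by_cases hp : IsLog V
  · refine ⟨4 ^ V.length, by positivity, fun z hz t ht => ?_⟩
    refine (abs_F_isLog_le hp z ht).trans ?_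
    gcongr
    exact (le_mul_of_one_le_left (zero_le_one.trans (one_le_rpow_quarter ht))
      (one_le_rpow_quarter ht)).trans (rpow_quarter_le ht)
  · obtain ⟨C, hC, h⟩ := exists_nw_le V hr R
    refine ⟨4 ^ V.length * C, by positivity, fun z hz t ht => ?_⟩
    refine (abs_F_le hp (hr.trans_le hz.1) ht).trans ?_
    have hb := beta_nonneg t
    gcongr
    · exact h z hz
    · rw [le_div_iff₀ ht.1]; nlinarith [ht.2]

theorem exists_dintegrand_le (x : Lt) {V : List Lt} {r : ℝ} (hr : 0 < r) (R : ℝ)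
    (hV : ∃ C, 0 ≤ C ∧ ∀ z ∈ Icc r R, ∀ t ∈ Ioo (0:ℝ) 1, |dF V z t| ≤ C * beta t) :
    ∃ C, 0 ≤ C ∧ ∀ z ∈ Icc r R, ∀ t ∈ Ioo (0:ℝ) 1,
      |dom x z t * F V z t + om x z t * dF V z t| ≤ C * (beta t / (t * (1 - t))) ∧
      (x ≠ i → |dom x z t * F V z t + om x z t * dF V z t| ≤ C * (beta t / t)) := by
  obtain ⟨C, hC, h⟩ := hV
  obtain ⟨D, hD, h'⟩ := exists_nl_le x hr R
  obtain ⟨E, hE, h''⟩ := exists_F_le V hr R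
  refine ⟨(1 + (r ^ 2)⁻¹) * E + D * C, by positivity, fun z hz t ht => ?_⟩
  have hz0 := hr.trans_le hz.1
  have hb := beta_nonneg t
  have h0 := ht.1
  have h1 : 0 < 1 - t := by linarith [ht.2]
  have hn := nl_pos x hz0
  have key1 : |dom x z t * F V z t| ≤ (1 + (r ^ 2)⁻¹) * E * (beta t / t) := by
    rw [abs_mul, mul_assoc]
    exact mul_le_mul (abs_dom_le x hr hz.1 h0) (h'' z hz t ht) (abs_nonneg _) (by positivity)
  constructor
  · have key2 : |om x z t * dF V z t| ≤ D * C * (beta t / (t * (1 - t))) := by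
      rw [abs_mul]
      calc |om x z t| * |dF V z t| ≤ (D / (t * (1 - t))) * (C * beta t) := by
            gcongr
            · exact (abs_om_le hz0 ht).trans (by gcongr; exact h' z hz)
            · exact h z hz t ht
        _ = _ := by ring
    refine (abs_add_le _ _).trans ?_
    rw [add_mul]
    refine add_le_add (key1.trans ?_) key2
    gcongr (1 + (r ^ 2)⁻¹) * E * ?_
    exact beta_div_le ht
  · intro hx
    have key2 : |om x z t * dF V z t| ≤ D * C * (beta t / t) := by
      rw [abs_mul]
      calc |om x z t| * |dF V z t| ≤ (D / t) * (C * beta t) := by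
            gcongr
            · rw [abs_of_pos (om_pos hx hz0 h0)]
              exact (om_le_div hx hz0 ⟨h0, ht.2.le⟩).trans (by gcongr; exact h' z hz)
            · exact h z hz t ht
        _ = _ := by ring
    refine (abs_add_le _ _).trans ?_
    rw [add_mul]
    exact add_le_add key1 key2

theorem dF_main (W : List Lt) :
    (∀ z, 0 < z → ContinuousOn (dF W z) (Ioo 0 1)) ∧ ∀ r, 0 < r → ∀ R,
    ∃ C, 0 ≤ C ∧ ∀ z ∈ Icc r R, ∀ t ∈ Ioo (0:ℝ) 1, |dF W z t| ≤ C * beta t := by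
  induction W with
  | nil =>
    exact ⟨fun z hz => by simp only [dF]; fun_prop, fun r hr R => ⟨0, le_rfl, by simp [dF]⟩⟩
  | cons x V ih =>
    by_cases h : IsLog (x :: V)
    · refine ⟨fun z hz => ?_, fun r hr R => ⟨0, le_rfl, by simp [dF_isLog h]⟩⟩
      have : dF (x :: V) z = fun t => 0 := funext fun t => dF_isLog h z t
      rw [this]; fun_prop
    · have hc : ∀ z, 0 < z →
          ContinuousOn (fun u => dom x z u * F V z u + om x z u * dF V z u) (Ioo 0 1) := fun z hz =>
        ((continuousOn_dom x hz).mul (continuousOn_F V hz)).add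
          ((continuousOn_om x hz).mul (ih.1 z hz))
      constructor
      · intro z hz
        have e : dF (x :: V) z = fun t =>
            ∫ u in (0:ℝ)..t, (dom x z u * F V z u + om x z u * dF V z u) :=
          funext fun t => dF_cons h z t
        rw [e]
        intro t ht
        obtain ⟨C, hC, hb⟩ := exists_dintegrand_le x hz z (ih.2 z hz z)
        exact (comparison (hc z hz)
          (fun u hu => (hb z ⟨le_rfl, le_rfl⟩ u hu).1) ht).2.1.continuousAt.continuousWithinAt
      · intro r hr R
        obtain ⟨C, hC, hb⟩ := exists_dintegrand_le x hr R (ih.2 r hr R)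
        refine ⟨2 * C, by positivity, fun z hz t ht => ?_⟩
        rw [dF_cons h]
        exact (comparison (hc z (hr.trans_le hz.1)) (fun u hu => (hb z hz u hu).1) ht).2.2

theorem continuousOn_dintegrand (x : Lt) (V : List Lt) {z : ℝ} (hz : 0 < z) :
    ContinuousOn (fun u => dom x z u * F V z u + om x z u * dF V z u) (Ioo 0 1) :=
  ((continuousOn_dom x hz).mul (continuousOn_F V hz)).add
    ((continuousOn_om x hz).mul ((dF_main V).1 z hz))

theorem ae_ne_one : ∀ᵐ t : ℝ ∂volume, t ≠ 1 := by simp [ae_iff]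

theorem aesm_of_continuousOn {g : ℝ → ℝ} (hg : ContinuousOn g (Ioo 0 1)) {t : ℝ}
    (ht : t ∈ Ioc (0:ℝ) 1) : AEStronglyMeasurable g (volume.restrict (uIoc 0 t)) := by
  rw [uIoc_of_le ht.1.le, ← Measure.restrict_congr_set (Ioo_ae_eq_Ioc (a := (0:ℝ)) (b := t))]
  exact (hg.mono (Ioo_subset_Ioo_right ht.2)).aestronglyMeasurable measurableSet_Ioo

theorem hasDerivAt_F_z_aux {x : Lt} {V : List Lt} (h : ¬ IsLog (x :: V))
    (hV : ∀ z, 0 < z → ∀ t ∈ Ioo (0:ℝ) 1, HasDerivAt (fun z => F V z t) (dF V z t) z)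
    {z : ℝ} (hz : 0 < z) {t : ℝ} (ht : t ∈ Ioc (0:ℝ) 1) (hx : t = 1 → x ≠ i) :
    IntervalIntegrable (fun u => dom x z u * F V z u + om x z u * dF V z u) volume 0 t ∧
    HasDerivAt (fun z => F (x :: V) z t) (dF (x :: V) z t) z := by
  have e : (fun z => F (x :: V) z t) = fun z => ∫ u in (0:ℝ)..t, om x z u * F V z u :=
    funext fun z => F_cons h z t
  rw [e, dF_cons h]
  have hr : 0 < z / 2 := by linarith
  obtain ⟨C, hC, hb⟩ := exists_dintegrand_le x hr (2 * z) ((dF_main V).2 _ hr (2 * z))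
  have hmem : Icc (z / 2) (2 * z) ∈ 𝓝 z := Icc_mem_nhds (by linarith) (by linarith)
  have hmemt : ∀ u, u ∈ uIoc 0 t → u ≠ 1 → u ∈ Ioo (0:ℝ) 1 := fun u hu hu1 => by
    rw [uIoc_of_le ht.1.le] at hu
    exact ⟨hu.1, lt_of_le_of_ne (hu.2.trans ht.2) hu1⟩
  refine intervalIntegral.hasDerivAt_integral_of_dominated_loc_of_deriv_le
    (bound := fun u => if t = 1 then C * (beta u / u) else C * (beta u / (u * (1 - u))))
    (F' := fun z u => dom x z u * F V z u + om x z u * dF V z u) hmem ?_ ?_ ?_ ?_ ?_ ?_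
  · filter_upwards [lt_mem_nhds hz] with z' hz'
    exact aesm_of_continuousOn (continuousOn_integrand x V hz') ht
  · exact integrable_integrand h hz ht hx
  · exact aesm_of_continuousOn (continuousOn_dintegrand x V hz) ht
  · filter_upwards [ae_ne_one] with u hu1 hu z' hz'
    have := hb z' hz' u (hmemt u hu hu1)
    by_cases h1 : t = 1
    · simpa [h1] using this.2 (hx h1)
    · simpa [h1] using this.1
  · by_cases h1 : t = 1
    · subst h1
      simpa using integrable_beta_one.const_mul C
    · simpa [h1] using (integrable_beta ⟨ht.1, lt_of_le_of_ne ht.2 h1⟩).1.const_mul C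
  · filter_upwards [ae_ne_one] with u hu1 hu z' hz'
    have hz0 : 0 < z' := by linarith [hz'.1]
    have hu' := hmemt u hu hu1
    exact ((hasDerivAt_om x hz0 hu').mul (hV z' hz0 u hu'))

theorem hasDerivAt_F_z_lt (W : List Lt) : ∀ z, 0 < z → ∀ t ∈ Ioo (0:ℝ) 1,
    HasDerivAt (fun z => F W z t) (dF W z t) z := by
  induction W with
  | nil => exact fun z hz t ht => by simpa [F, dF] using hasDerivAt_const z (1:ℝ)
  | cons x V ih =>
    intro z hz t ht
    by_cases h : IsLog (x :: V)
    · rw [dF_isLog h]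
      exact (hasDerivAt_const z _).congr_of_eventuallyEq
        (Eventually.of_forall fun z' => F_isLog h z' t)
    · exact (hasDerivAt_F_z_aux h ih hz ⟨ht.1, ht.2.le⟩ fun h1 => absurd h1 ht.2.ne).2

theorem hasDerivAt_F_z_one {W : List Lt} (hW : W.headD o ≠ i) {z : ℝ} (hz : 0 < z) :
    HasDerivAt (fun z => F W z 1) (dF W z 1) z := by
  by_cases h : IsLog W
  · rw [dF_isLog h]
    exact (hasDerivAt_const z _).congr_of_eventuallyEq
      (Eventually.of_forall fun z' => F_isLog h z' 1)
  · cases W with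
    | nil => exact absurd isLog_nil h
    | cons x V =>
      exact (hasDerivAt_F_z_aux h (hasDerivAt_F_z_lt V) hz ⟨one_pos, le_rfl⟩
        fun _ => by simpa using hW).2

theorem tendsto_F_one_z {W : List Lt} (hW : W.headD o ≠ i) :
    Tendsto (fun z => F W z 1) (𝓝[<] 1) (𝓝 (F W 1 1)) :=
  (hasDerivAt_F_z_one hW one_pos).continuousAt.tendsto.mono_left nhdsWithin_le_nhds

theorem tendsto_F_zero_z {W : List Lt} (hW : W.headD o ≠ i) (hm : m ∈ W) (hM : W.count M ≤ 1) :
    Tendsto (fun z => F W z 1) (𝓝[>] 0) (𝓝 0) := by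
  have hl : ¬ IsLog W := fun h => by simpa using h m hm
  obtain ⟨C, hC⟩ := abs_F_one_le hl hW
  have h1 : ∀ V : List Lt, V.count M = 0 → ∀ z ∈ Ioo (0:ℝ) 1, nw V z ≤ 1 := by
    intro V
    induction V with
    | nil => intro _ z _; simp [nw]
    | cons x V ih =>
      intro hV z hz
      rw [List.count_cons] at hV
      have hx : x ≠ M := by rintro rfl; simp at hV
      rw [nw_cons]
      have h2 : nl x z ≤ 1 := by cases x <;> simp_all [nl]; exact hz.2.le
      have := ih (by omega) z hz
      have := nw_pos V hz.1
      have := nl_pos x hz.1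
      nlinarith
  have h2 : ∀ V : List Lt, V.count M ≤ 1 → ∀ z ∈ Ioo (0:ℝ) 1, nw V z ≤ z ^ (-(3/4) : ℝ) := by
    intro V
    induction V with
    | nil =>
      intro _ z hz
      simpa [nw] using Real.one_le_rpow_of_pos_of_le_one_of_nonpos hz.1 hz.2.le (by norm_num)
    | cons x V ih =>
      intro hV z hz
      rw [List.count_cons] at hV
      rw [nw_cons]
      have hn := nw_pos V hz.1
      have hp := nl_pos x hz.1
      by_cases hx : x = M
      · subst hx
        have := h1 V (by simpa using hV) z hz
        simp only [nl] at hp ⊢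
        nlinarith
      · have h2 : nl x z ≤ 1 := by cases x <;> simp_all [nl]; exact hz.2.le
        have := ih (by omega) z hz
        nlinarith
  have h3 : ∀ V : List Lt, m ∈ V → V.count M ≤ 1 → ∀ z ∈ Ioo (0:ℝ) 1, nw V z ≤ z ^ (1/4 : ℝ) := by
    intro V
    induction V with
    | nil => intro h; simp at h
    | cons x V ih =>
      intro hm hV z hz
      rw [List.count_cons] at hV
      rw [nw_cons]
      have hn := nw_pos V hz.1
      have hp := nl_pos x hz.1
      have e : z * z ^ (-(3/4) : ℝ) = z ^ (1/4 : ℝ) := by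
        nth_rewrite 1 [← Real.rpow_one z]
        rw [← Real.rpow_add hz.1]; norm_num
      by_cases hx : x = m
      · subst hx
        have := h2 V (by omega) z hz
        rw [← e]
        simp only [nl] at hp ⊢
        gcongr
      · have hmV : m ∈ V := by
          rcases List.mem_cons.1 hm with h | h
          · exact absurd h.symm hx
          · exact h
        by_cases hxM : x = M
        · subst hxM
          have hV0 : V.count M = 0 := by simpa using hV
          have h4 : ∀ U : List Lt, m ∈ U → U.count M = 0 → nw U z ≤ z := by
            intro U
            induction U with
            | nil => intro h; simp at h
            | cons y U ihU =>
              intro hmU hU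
              rw [List.count_cons] at hU
              rw [nw_cons]
              have hn := nw_pos U hz.1
              have hp := nl_pos y hz.1
              by_cases hy : y = m
              · subst hy
                have := h1 U (by omega) z hz
                simp only [nl] at hp ⊢
                nlinarith
              · have hyM : y ≠ M := by rintro rfl; simp at hU
                have h2 : nl y z ≤ 1 := by cases y <;> simp_all [nl]
                have hmU' : m ∈ U := by
                  rcases List.mem_cons.1 hmU with h | h
                  · exact absurd h.symm hy
                  · exact h
                have := ihU hmU' (by omega)
                nlinarith
          have := h4 V hmV hV0
          rw [← e, mul_comm z]
          simp only [nl] at hp ⊢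
          gcongr
        · have h2 : nl x z ≤ 1 := by cases x <;> simp_all [nl]
          have := ih hmV (by omega) z hz
          nlinarith
  have hC0 : 0 ≤ C := by
    have := hC 1 one_pos
    have h' := nw_pos W one_pos
    by_contra hneg
    push Not at hneg
    nlinarith [abs_nonneg (F W 1 1)]
  refine squeeze_zero_norm' (a := fun z => C * z ^ (1/4 : ℝ)) ?_ ?_
  · filter_upwards [Ioo_mem_nhdsGT zero_lt_one] with z hz
    exact (hC z hz.1).trans (mul_le_mul_of_nonneg_left (h3 W hm hM z hz) hC0)
  · have h : ContinuousAt (fun z : ℝ => C * z ^ (1/4 : ℝ)) 0 :=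
      continuousAt_const.mul (Real.continuousAt_rpow_const 0 (1/4) (Or.inr (by norm_num)))
    rw [ContinuousAt, Real.zero_rpow (by norm_num), mul_zero] at h
    exact h.mono_left nhdsWithin_le_nhds

/-- The combinatorial shape of the differential equation of iterated integrals. -/
def der (κ : Lt → Lt → ℝ) : (Lt → ℝ) → List Lt → (List Lt → ℝ) → ℝ
  | _, [], _ => 0
  | k, x :: W, φ => (k x - κ x (W.headD o)) * φ W + der κ (fun y => κ y x) W fun V => φ (x :: V)

theorem pt_o (z : ℝ) : pt o z = 0 := rfl
theorem dpt_o (z : ℝ) : dpt o z = 0 := rfl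
theorem pt_i (z : ℝ) : pt i z = 1 := rfl
theorem dpt_i (z : ℝ) : dpt i z = 0 := rfl

/-- Logarithmic derivative of differences of singular points. -/
noncomputable def kap (z : ℝ) (x y : Lt) : ℝ := (dpt x z - dpt y z) / (pt x z - pt y z)

noncomputable def kapt (z t : ℝ) (x : Lt) : ℝ := dpt x z / (pt x z - t)

theorem kap_symm (z : ℝ) (x y : Lt) : kap z x y = kap z y x := by
  rw [kap, kap, ← neg_sub (dpt y z), ← neg_sub (pt y z), neg_div_neg_eq]

theorem kap_self (z : ℝ) (x : Lt) : kap z x x = 0 := by simp [kap]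

theorem der_cons (κ : Lt → Lt → ℝ) (k : Lt → ℝ) (x : Lt) (W : List Lt) (φ : List Lt → ℝ) :
    der κ k (x :: W) φ =
      (k x - κ x (W.headD o)) * φ W + der κ (fun y => κ y x) W fun V => φ (x :: V) := rfl

theorem der_mul (κ : Lt → Lt → ℝ) (k : Lt → ℝ) (W : List Lt) (φ : List Lt → ℝ) (c : ℝ) :
    der κ k W (fun V => c * φ V) = c * der κ k W φ := by
  induction W generalizing k φ with
  | nil => simp [der]
  | cons x W ih => rw [der_cons, der_cons, ih]; ring

theorem der_sub_der (κ : Lt → Lt → ℝ) (k k' : Lt → ℝ) (x : Lt) (W : List Lt)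
    (φ : List Lt → ℝ) :
    der κ k (x :: W) φ - der κ k' (x :: W) φ = (k x - k' x) * φ W := by
  rw [der_cons, der_cons]; ring

theorem hasDerivAt_der (κ : Lt → Lt → ℝ) (k : Lt → ℝ) (W : List Lt) {Φ : List Lt → ℝ → ℝ}
    {Φ' : List Lt → ℝ} {t : ℝ} (h : ∀ V, HasDerivAt (Φ V) (Φ' V) t) :
    HasDerivAt (fun t => der κ k W fun V => Φ V t) (der κ k W Φ') t := by
  induction W generalizing k Φ Φ' with
  | nil => exact hasDerivAt_const t (0:ℝ)
  | cons x W ih => exact ((h W).const_mul _).add (ih _ fun V => h (x :: V))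

theorem tendsto_der {ι : Type*} {l : Filter ι} (κ : Lt → Lt → ℝ) (k : Lt → ℝ) (W : List Lt)
    {Φ : List Lt → ι → ℝ} {Φ' : List Lt → ℝ} (h : ∀ V, Tendsto (Φ V) l (𝓝 (Φ' V))) :
    Tendsto (fun t => der κ k W fun V => Φ V t) l (𝓝 (der κ k W Φ')) := by
  induction W generalizing k Φ Φ' with
  | nil => exact tendsto_const_nhds
  | cons x W ih => exact ((h W).const_mul _).add (ih _ fun V => h (x :: V))

theorem der_congr_of_not_isLog (κ : Lt → Lt → ℝ) (W : List Lt)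
    {φ φ' : List Lt → ℝ} (h : ∀ V, ¬ IsLog V → φ V = φ' V) :
    der κ (fun y => κ y o) W φ = der κ (fun y => κ y o) W φ' := by
  induction W generalizing φ φ' with
  | nil => rfl
  | cons x W ih =>
    rw [der_cons, der_cons]
    have hW : (κ x o - κ x (W.headD o)) * φ W = (κ x o - κ x (W.headD o)) * φ' W := by
      by_cases hl : IsLog W
      · have : W.headD o = o := by
          cases W with
          | nil => rfl
          | cons y V => exact hl y (by simp)
        rw [this]; simp
      · rw [h W hl]
    rw [hW]
    congr 1
    by_cases hx : x = o
    · subst hx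
      exact ih fun V hV => h _ fun h' => hV (isLog_cons.1 h').2
    · congr 1
      funext V
      exact h _ fun h' => hx (isLog_cons.1 h').1

theorem der_isLog (κ : Lt → Lt → ℝ) (hκ : κ o o = 0) (k : Lt → ℝ) (hk : k o = 0) {W : List Lt}
    (h : IsLog W) (φ : List Lt → ℝ) : der κ k W φ = 0 := by
  induction W generalizing k φ with
  | nil => rfl
  | cons x W ih =>
    obtain ⟨rfl, hl⟩ := isLog_cons.1 h
    have : W.headD o = o := by
      cases W with
      | nil => rfl
      | cons y V => exact hl y (by simp)
    rw [der_cons, this, hk, hκ, ih (fun y => κ y o) hκ hl]; ring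

theorem pt_ne_pt {x y : Lt} (h : x ≠ y) {z : ℝ} (hz : z ∈ Ioo (0:ℝ) 1) : pt x z - pt y z ≠ 0 := by
  have h1 : 1 < z⁻¹ := (one_lt_inv₀ hz.1).2 hz.2
  have := hz.1
  have := hz.2
  rw [sub_ne_zero]
  cases x <;> cases y <;> simp only [pt] <;> first | exact absurd rfl h | (apply ne_of_gt; linarith) | (apply ne_of_lt; linarith)

theorem om_mul_kap {x y : Lt} {z t : ℝ} (hz : z ∈ Ioo (0:ℝ) 1) (ht : t ∈ Ioo (0:ℝ) 1) :
    om x z t * (kapt z t y - kap z y x) = (kapt z t x - kap z x y) * om y z t := by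
  by_cases h : x = y
  · subst h; ring
  have h1 := sub_pt_ne (x := x) hz.1 ht
  have h2 := sub_pt_ne (x := y) hz.1 ht
  have h3 := pt_ne_pt h hz
  have h4 := pt_ne_pt (Ne.symm h) hz
  have h5 : pt x z - t ≠ 0 := by rw [← neg_sub]; exact neg_ne_zero.2 h1
  have h6 : pt y z - t ≠ 0 := by rw [← neg_sub]; exact neg_ne_zero.2 h2
  rw [kap_symm z y x]
  simp only [om, kapt, kap]
  have e1 : t - pt x z = -(pt x z - t) := by ring
  have e2 : t - pt y z = -(pt y z - t) := by ring
  rw [e1, e2, inv_neg, inv_neg]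
  field_simp
  ring

theorem hasDerivAt_kapt (x : Lt) {z t : ℝ} (hz : 0 < z) (ht : t ∈ Ioo (0:ℝ) 1) :
    HasDerivAt (fun t => kapt z t x) (dom x z t) t := by
  have h1 := sub_pt_ne (x := x) hz ht
  have h5 : pt x z - t ≠ 0 := by rw [← neg_sub]; exact neg_ne_zero.2 h1
  refine (((hasDerivAt_id t).const_sub (pt x z)).inv h5 |>.const_mul (dpt x z)).congr_deriv ?_
    |>.congr_of_eventuallyEq (Eventually.of_forall fun t => ?_)
  · have : (t - pt x z) ^ 2 = (pt x z - t) ^ 2 := by ring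
    simp [dom, this, div_eq_mul_inv]
  · simp [kapt, div_eq_mul_inv]

theorem hasDerivAt_F_all (z : ℝ) (hz : 0 < z) {t : ℝ} (ht : t ∈ Ioo (0:ℝ) 1) (V : List Lt) :
    HasDerivAt (F V z) (match V with | [] => 0 | x :: V => om x z t * F V z t) t := by
  cases V with
  | nil => exact hasDerivAt_const t (1:ℝ)
  | cons x V => exact hasDerivAt_F x V hz ht

theorem hasDerivAt_der_F (x : Lt) (V : List Lt) {z : ℝ} (hz : z ∈ Ioo (0:ℝ) 1) {t : ℝ}
    (ht : t ∈ Ioo (0:ℝ) 1) :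
    HasDerivAt (fun t => der (kap z) (kapt z t) (x :: V) fun U => F U z t)
      (dom x z t * F V z t + om x z t * der (kap z) (kapt z t) V fun U => F U z t) t := by
  have h1 := ((hasDerivAt_kapt x hz.1 ht).sub_const (kap z x (V.headD o))).mul
    (hasDerivAt_F_all z hz.1 ht V)
  have h2 := hasDerivAt_der (kap z) (fun y => kap z y x) V (t := t)
    (Φ := fun U => F (x :: U) z) (Φ' := fun U => om x z t * F U z t)
    fun U => hasDerivAt_F x U hz.1 ht
  refine (h1.add h2).congr_deriv ?_
  rw [der_mul, add_assoc]
  congr 1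
  cases V with
  | nil => simp [der]
  | cons y U =>
    have h3 := der_sub_der (kap z) (kapt z t) (fun y => kap z y x) y U fun U => F U z t
    have h4 := om_mul_kap (x := x) (y := y) hz ht
    simp only [List.headD_cons]
    linear_combination -(om x z t) * h3 - F U z t * h4

theorem tendsto_der_zero {W : List Lt} {z : ℝ} (hz : z ∈ Ioo (0:ℝ) 1) :
    Tendsto (fun t => der (kap z) (kapt z t) W fun U => F U z t) (𝓝[>] 0) (𝓝 0) := by
  cases W with
  | nil => exact tendsto_const_nhds
  | cons x V =>
    have e : ∀ t, (der (kap z) (kapt z t) (x :: V) fun U => F U z t) =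
        (kapt z t x - kap z x o) * F V z t + der (kap z) (fun y => kap z y o) (x :: V)
          fun U => if IsLog U then 0 else F U z t := by
      intro t
      rw [der_congr_of_not_isLog (kap z) (x :: V) (φ' := fun U => F U z t)
        (fun U hU => if_neg hU)]
      have := der_sub_der (kap z) (kapt z t) (fun y => kap z y o) x V fun U => F U z t
      linear_combination this
    simp only [e]
    have h2 := tendsto_der (l := 𝓝[>] (0:ℝ)) (kap z) (fun y => kap z y o) (x :: V)
      (Φ := fun U t => if IsLog U then 0 else F U z t) (Φ' := fun _ => 0 * 0) (fun U => by
        by_cases h : IsLog U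
        · simp only [if_pos h, zero_mul]; exact tendsto_const_nhds
        · simp only [if_neg h, zero_mul]; exact tendsto_F_zero h hz.1)
    rw [der_mul, zero_mul] at h2
    suffices h : Tendsto (fun t => (kapt z t x - kap z x o) * F V z t) (𝓝[>] 0) (𝓝 0) by
      simpa using h.add h2
    by_cases hx : x = o
    · subst hx
      simp [kapt, kap, dpt_o]
    have hp : pt x z ≠ 0 := by simpa [pt] using pt_ne_pt hx hz
    have hk : Tendsto (fun t => kapt z t x - kap z x o) (𝓝[>] 0) (𝓝 0) := by
      have : ContinuousAt (fun t => kapt z t x - kap z x o) 0 := by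
        unfold kapt
        have : pt x z - 0 ≠ 0 := by simpa using hp
        fun_prop (disch := assumption)
      have h0 : kapt z 0 x - kap z x o = 0 := by
        simp [kapt, kap, dpt, pt]
      rw [ContinuousAt, h0] at this
      exact this.mono_left nhdsWithin_le_nhds
    by_cases hV : IsLog V
    · have e2 : ∀ t, t ∈ Ioo (0:ℝ) 1 → (kapt z t x - kap z x o) * F V z t =
          (dpt x z / (pt x z * (pt x z - t))) * (t * F V z t) := by
        intro t ht
        have h5 : pt x z - t ≠ 0 := by
          rw [← neg_sub]; exact neg_ne_zero.2 (sub_pt_ne hz.1 ht)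
        rw [kapt, kap, pt_o, dpt_o, sub_zero, sub_zero]
        field_simp
        ring
      have h3 : Tendsto (fun t => (dpt x z / (pt x z * (pt x z - t)))) (𝓝[>] 0)
          (𝓝 (dpt x z / (pt x z * (pt x z - 0)))) := by
        have : ContinuousAt (fun t => (dpt x z / (pt x z * (pt x z - t)))) 0 := by
          have : pt x z * (pt x z - 0) ≠ 0 := by simpa using hp
          fun_prop (disch := assumption)
        exact this.tendsto.mono_left nhdsWithin_le_nhds
      have h4 : Tendsto (fun t => t * F V z t) (𝓝[>] 0) (𝓝 0) := by
        obtain ⟨C, -, hC⟩ := exists_F_le V hz.1 z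
        refine squeeze_zero_norm' (a := fun t => C * beta t) ?_ ?_
        · filter_upwards [Ioo_mem_nhdsGT zero_lt_one] with t ht
          have ht0 := ht.1
          rw [norm_mul, Real.norm_of_nonneg ht0.le, Real.norm_eq_abs]
          calc t * |F V z t| ≤ t * (C * (beta t / t)) := by
                gcongr; exact hC z ⟨le_rfl, le_rfl⟩ t ht
            _ = _ := by field_simp
        · simpa using tendsto_beta_zero.const_mul C
      have := h3.mul h4
      rw [mul_zero] at this
      refine this.congr' ?_
      filter_upwards [Ioo_mem_nhdsGT zero_lt_one] with t ht using (e2 t ht).symm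
    · simpa using hk.mul (tendsto_F_zero hV hz.1)

theorem dF_eq_der_lt (W : List Lt) {z : ℝ} (hz : z ∈ Ioo (0:ℝ) 1) : ∀ t ∈ Ioo (0:ℝ) 1,
    dF W z t = der (kap z) (kapt z t) W fun U => F U z t := by
  induction W with
  | nil => intro t ht; rfl
  | cons x V ih =>
    intro t ht
    by_cases h : IsLog (x :: V)
    · rw [dF_isLog h, der_isLog _ (kap_self z o) _ _ h]
      simp [kapt, dpt]
    rw [dF_cons h]
    have hI := (hasDerivAt_F_z_aux h (hasDerivAt_F_z_lt V) hz.1 ⟨ht.1, ht.2.le⟩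
      fun h1 => absurd h1 ht.2.ne).1
    rw [intervalIntegral.integral_eq_sub_of_hasDerivAt_of_tendsto ht.1 (fun u hu => ?_) hI
      (tendsto_der_zero (W := x :: V) hz)
      ((hasDerivAt_der_F x V hz ht).continuousAt.tendsto.mono_left nhdsWithin_le_nhds), sub_zero]
    have hu' : u ∈ Ioo (0:ℝ) 1 := ⟨hu.1, hu.2.trans ht.2⟩
    rw [ih u hu']
    exact hasDerivAt_der_F x V hz hu'

theorem dF_eq_der_one {W : List Lt} (hW : W.headD o ≠ i) {z : ℝ} (hz : z ∈ Ioo (0:ℝ) 1) :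
    dF W z 1 = der (kap z) (fun y => kap z y i) W fun U => F U z 1 := by
  by_cases h : IsLog W
  · rw [dF_isLog h, der_isLog _ (kap_self z o) _ _ h]
    simp [kap, dpt]
  cases W with
  | nil => rfl
  | cons x V =>
    have hx : x ≠ i := by simpa using hW
    rw [dF_cons h]
    have hI := (hasDerivAt_F_z_aux h (hasDerivAt_F_z_lt V) hz.1 ⟨one_pos, le_rfl⟩ fun _ => hx).1
    suffices hlim : Tendsto (fun t => der (kap z) (kapt z t) (x :: V) fun U => F U z t) (𝓝[<] 1)
        (𝓝 (der (kap z) (fun y => kap z y i) (x :: V) fun U => F U z 1)) by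
      rw [intervalIntegral.integral_eq_sub_of_hasDerivAt_of_tendsto one_pos (fun u hu => ?_) hI
        (tendsto_der_zero (W := x :: V) hz) hlim, sub_zero]
      rw [dF_eq_der_lt V hz u hu]
      exact hasDerivAt_der_F x V hz hu
    have h5 : pt x z - 1 ≠ 0 := pt_ne_pt hx hz
    have hk : Tendsto (fun t => kapt z t x) (𝓝[<] 1) (𝓝 (kap z x i)) := by
      have : ContinuousAt (fun t => kapt z t x) 1 := by
        unfold kapt
        fun_prop (disch := assumption)
      have h0 : kapt z 1 x = kap z x i := by simp [kapt, kap, dpt, pt]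
      rw [ContinuousAt, h0] at this
      exact this.mono_left nhdsWithin_le_nhds
    refine Tendsto.add ?_ ?_
    · by_cases hV : V.headD o = i
      · rw [hV, sub_self, zero_mul]
        have hl : ¬ IsLog V := by
          intro hl
          cases V with
          | nil => simp at hV
          | cons y U => have := hl y (by simp); simp_all
        have h3 : Tendsto (fun t => dpt x z / ((pt x z - 1) * (pt x z - t))) (𝓝[<] 1)
            (𝓝 (dpt x z / ((pt x z - 1) * (pt x z - 1)))) := by
          have : ContinuousAt (fun t => (dpt x z / ((pt x z - 1) * (pt x z - t)))) 1 := by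
            have : (pt x z - 1) * (pt x z - 1) ≠ 0 := mul_ne_zero h5 h5
            fun_prop (disch := assumption)
          exact this.tendsto.mono_left nhdsWithin_le_nhds
        have h4 : Tendsto (fun t => (1 - t) * F V z t) (𝓝[<] 1) (𝓝 0) := by
          refine squeeze_zero_norm' (a := fun t => 4 ^ V.length * nw V z * √(1 - t)) ?_ ?_
          · filter_upwards [Ioo_mem_nhdsLT zero_lt_one] with t ht
            have h1 : 0 < 1 - t := by linarith [ht.2]
            rw [norm_mul, Real.norm_of_nonneg h1.le, Real.norm_eq_abs]
            have hn := nw_pos V hz.1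
            calc (1 - t) * |F V z t| ≤ (1 - t) * (4 ^ V.length * nw V z * beta t) := by
                  gcongr; exact abs_F_le hl hz.1 ht
              _ = 4 ^ V.length * nw V z * ((1 - t) * beta t) := by ring
              _ ≤ _ := by
                gcongr
                rw [beta, Real.sqrt_div ht.1.le]
                have hs := Real.sqrt_pos.2 h1
                have e1 : √(1 - t) ^ 2 = 1 - t := Real.sq_sqrt h1.le
                nth_rewrite 1 [← e1]
                rw [mul_div_assoc', div_le_iff₀ hs]
                have : √t ≤ 1 := Real.sqrt_le_one.2 ht.2.le
                nlinarith [sq_nonneg √(1-t)]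
          · have : ContinuousAt (fun t : ℝ => 4 ^ V.length * nw V z * √(1 - t)) 1 := by fun_prop
            rw [ContinuousAt, sub_self, Real.sqrt_zero, mul_zero] at this
            exact this.mono_left nhdsWithin_le_nhds
        have := (h3.mul h4).neg
        rw [mul_zero, neg_zero] at this
        refine this.congr' ?_
        filter_upwards [Ioo_mem_nhdsLT zero_lt_one] with t ht
        have h6 : pt x z - t ≠ 0 := by
          rw [← neg_sub]; exact neg_ne_zero.2 (sub_pt_ne hz.1 ht)
        rw [kapt, kap, pt_i, dpt_i, sub_zero]
        field_simp
        ring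
      · exact (hk.sub_const _).mul (tendsto_F_one hV hz.1)
    · exact tendsto_der (kap z) (fun y => kap z y x) V (Φ := fun U t => F (x :: U) z t)
        (Φ' := fun U => F (x :: U) z 1) fun U => tendsto_F_one (by simpa using hx) hz.1

/-- The differential equation of the values at `1`. -/
theorem hasDerivAt_F_one_z {W : List Lt} (hW : W.headD o ≠ i) {z : ℝ} (hz : z ∈ Ioo (0:ℝ) 1) :
    HasDerivAt (fun z => F W z 1) (der (kap z) (fun y => kap z y i) W fun U => F U z 1) z :=
  dF_eq_der_one hW hz ▸ hasDerivAt_F_z_one hW hz.1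

section Shuffle
variable {α : Type*}

/-- The shuffles of two words. -/
def sh : List α → List α → List (List α)
  | [], v => [v]
  | x :: u, [] => [x :: u]
  | x :: u, y :: v => (sh u (y :: v)).map (x :: ·) ++ (sh (x :: u) v).map (y :: ·)
termination_by u v => u.length + v.length

theorem sh_nil_left (v : List α) : sh [] v = [v] := by rw [sh]

theorem sh_nil_right (u : List α) : sh u [] = [u] := by cases u <;> rw [sh]

theorem sh_cons_cons (x y : α) (u v : List α) : sh (x :: u) (y :: v) =
    (sh u (y :: v)).map (x :: ·) ++ (sh (x :: u) v).map (y :: ·) := by rw [sh]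

theorem perm_of_mem_sh {u v s : List α} (h : s ∈ sh u v) : s.Perm (u ++ v) := by
  induction u, v using sh.induct generalizing s with
  | case1 v => simp_all [sh_nil_left]
  | case2 x u => simp_all [sh_nil_right]
  | case3 x u y v ih1 ih2 =>
    rw [sh_cons_cons, List.mem_append, List.mem_map, List.mem_map] at h
    rcases h with ⟨a, ha, rfl⟩ | ⟨a, ha, rfl⟩
    · exact (ih1 ha).cons x
    · exact ((ih2 ha).cons y).trans (List.perm_middle.symm)

theorem head_of_mem_sh {u v s : List α} {d : α} (h : s ∈ sh u v) :
    s.headD d = u.headD d ∨ s.headD d = v.headD d := by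
  cases u with
  | nil => simp_all [sh_nil_left]
  | cons x u =>
    cases v with
    | nil => simp_all [sh_nil_right]
    | cons y v =>
      rw [sh_cons_cons, List.mem_append, List.mem_map, List.mem_map] at h
      rcases h with ⟨a, ha, rfl⟩ | ⟨a, ha, rfl⟩ <;> simp

/-- The sum of a function over the shuffles of two words. -/
def shs (φ : List α → ℝ) (u v : List α) : ℝ := ((sh u v).map φ).sum

theorem shs_nil_left (φ : List α → ℝ) (v : List α) : shs φ [] v = φ v := by
  simp [shs, sh_nil_left]

theorem shs_nil_right (φ : List α → ℝ) (u : List α) : shs φ u [] = φ u := by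
  simp [shs, sh_nil_right]

theorem shs_cons_cons (φ : List α → ℝ) (x y : α) (u v : List α) : shs φ (x :: u) (y :: v) =
    shs (fun s => φ (x :: s)) u (y :: v) + shs (fun s => φ (y :: s)) (x :: u) v := by
  simp [shs, sh_cons_cons, Function.comp_def]

theorem shs_mul (c : ℝ) (φ : List α → ℝ) (u v : List α) :
    shs (fun s => c * φ s) u v = c * shs φ u v := by
  simp [shs, List.sum_map_mul_left]

theorem shs_mem {A : AddSubgroup ℝ} {φ : List α → ℝ} {u v : List α}
    (h : ∀ s ∈ sh u v, φ s ∈ A) : shs φ u v ∈ A :=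
  A.list_sum_mem (by simpa using h)

theorem tendsto_list_sum {ι : Type*} {l : Filter ι} (L : List α) {Φ : α → ι → ℝ} {a : α → ℝ}
    (h : ∀ s ∈ L, Tendsto (Φ s) l (𝓝 (a s))) :
    Tendsto (fun t => (L.map fun s => Φ s t).sum) l (𝓝 (L.map a).sum) := by
  induction L with
  | nil => exact tendsto_const_nhds
  | cons x L ih =>
    simp only [List.map_cons, List.sum_cons]
    exact (h x (by simp)).add (ih fun s hs => h s (by simp [hs]))

theorem hasDerivAt_list_sum (L : List α) {Φ : α → ℝ → ℝ} {Φ' : α → ℝ} {t : ℝ}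
    (h : ∀ s ∈ L, HasDerivAt (Φ s) (Φ' s) t) :
    HasDerivAt (fun t => (L.map fun s => Φ s t).sum) (L.map Φ').sum t := by
  induction L with
  | nil => exact hasDerivAt_const t (0:ℝ)
  | cons x L ih =>
    simp only [List.map_cons, List.sum_cons]
    exact (h x (by simp)).add (ih fun s hs => h s (by simp [hs]))

/-- The sum of a function over the splittings of a word. -/
def spl : (List α → List α → ℝ) → List α → ℝ
  | ψ, [] => ψ [] []
  | ψ, y :: v => ψ [] (y :: v) + spl (fun a b => ψ (y :: a) b) v

theorem spl_add (ψ ψ' : List α → List α → ℝ) (v : List α) :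
    spl (fun a b => ψ a b + ψ' a b) v = spl ψ v + spl ψ' v := by
  induction v generalizing ψ ψ' with
  | nil => rfl
  | cons y v ih => simp only [spl, ih]; ring

theorem spl_mem {A : AddSubgroup ℝ} {ψ : List α → List α → ℝ} {v : List α}
    (h : ∀ a b, a ++ b = v → ψ a b ∈ A) : spl ψ v ∈ A := by
  induction v generalizing ψ with
  | nil => exact h [] [] rfl
  | cons y v ih =>
    exact A.add_mem (h _ _ rfl) (ih fun a b hab => h _ _ (by simp [hab]))

/-- Shuffling a word with a marked letter. -/
theorem shs_append_cons (φ : List α → ℝ) (p : List α) (q : α) (r v : List α) :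
    shs φ (p ++ q :: r) v =
      spl (fun v' v'' => shs (fun a => shs (fun s => φ (a ++ q :: s)) r v'') p v') v := by
  induction p generalizing φ v with
  | nil =>
    simp only [List.nil_append, shs_nil_left]
    induction v generalizing φ with
    | nil => simp [spl, shs_nil_right]
    | cons y v ih =>
      rw [shs_cons_cons, ih]
      simp [spl]
  | cons x p ihp =>
    induction v generalizing φ with
    | nil => simp [spl, shs_nil_right]
    | cons y v ih =>
      rw [List.cons_append, shs_cons_cons, ihp, ← List.cons_append, ih]
      simp only [spl, shs_cons_cons, spl_add, shs_nil_right, List.cons_append]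
      ring

end Shuffle

theorem eq_const_of_hasDerivAt_zero {g : ℝ → ℝ} (h : ∀ t ∈ Ioo (0:ℝ) 1, HasDerivAt g 0 t) :
    ∃ C, ∀ t ∈ Ioo (0:ℝ) 1, g t = C := by
  refine ⟨g (1/2), fun t ht => ?_⟩
  exact (convex_Ioo (0:ℝ) 1).is_const_of_fderivWithin_eq_zero
    (fun u hu => (h u hu).differentiableAt.differentiableWithinAt)
    (fun u hu => by
      rw [fderivWithin_of_isOpen isOpen_Ioo hu]
      ext
      simp [(h u hu).deriv]) ht (by norm_num)

theorem eq_zero_of_tendsto {g : ℝ → ℝ} {C : ℝ} {l : Filter ℝ} [l.NeBot] (h : ∀ᶠ t in l, g t = C)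
    (hl : Tendsto g l (𝓝 0)) : C = 0 :=
  tendsto_nhds_unique tendsto_const_nhds ((tendsto_congr' h).1 hl)

theorem tendsto_F_mul_F_zero {u v : List Lt} (hu : ¬ IsLog u) {z : ℝ} (hz : 0 < z) :
    Tendsto (fun t => F u z t * F v z t) (𝓝[>] 0) (𝓝 0) := by
  by_cases hv : IsLog v
  · refine squeeze_zero_norm' (a := fun t => 4 ^ u.length * nw u z * 4 ^ v.length *
      (t ^ (1/4 : ℝ) / √(1 - t))) ?_ ?_
    · filter_upwards [Ioo_mem_nhdsGT zero_lt_one] with t ht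
      have hn := nw_pos u hz
      have ht0 := ht.1
      have h1 : 0 < 1 - t := by linarith [ht.2]
      have hb := beta_nonneg t
      rw [norm_mul, Real.norm_eq_abs, Real.norm_eq_abs]
      calc |F u z t| * |F v z t| ≤
          (4 ^ u.length * nw u z * beta t) * (4 ^ v.length * t ^ (-(1/4) : ℝ)) := by
            gcongr
            · exact abs_F_le hu hz ht
            · exact abs_F_isLog_le hv z ht
        _ = 4 ^ u.length * nw u z * 4 ^ v.length * (t ^ (-(1/4) : ℝ) * beta t) := by ring
        _ = _ := by
          rw [beta, Real.sqrt_div ht0.le, mul_div_assoc', Real.sqrt_eq_rpow t, ← Real.rpow_add ht0]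
          norm_num
    · have : ContinuousAt (fun t : ℝ => 4 ^ u.length * nw u z * 4 ^ v.length *
          (t ^ (1/4 : ℝ) / √(1 - t))) 0 := by
        refine continuousAt_const.mul (ContinuousAt.div
          (Real.continuousAt_rpow_const 0 (1/4) (Or.inr (by norm_num))) (by fun_prop) (by simp))
      rw [ContinuousAt, Real.zero_rpow (by norm_num), zero_div, mul_zero] at this
      exact this.mono_left nhdsWithin_le_nhds
  · simpa using (tendsto_F_zero hu hz).mul (tendsto_F_zero hv hz)

/-- The shuffle product of iterated integrals. -/
theorem F_mul_F {z : ℝ} (hz : 0 < z) (u v : List Lt) : ∀ t ∈ Ioo (0:ℝ) 1,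
    F u z t * F v z t = shs (fun s => F s z t) u v := by
  induction u, v using sh.induct with
  | case1 v => intro t ht; simp [shs_nil_left, F]
  | case2 x u => intro t ht; simp [shs_nil_right, F]
  | case3 x u y v ih1 ih2 =>
    have hd : ∀ t ∈ Ioo (0:ℝ) 1, HasDerivAt (fun t => F (x :: u) z t * F (y :: v) z t -
        shs (fun s => F s z t) (x :: u) (y :: v)) 0 t := by
      intro t ht
      have h1 := (hasDerivAt_F x u hz ht).mul (hasDerivAt_F y v hz ht)
      have h2 := hasDerivAt_list_sum (sh u (y :: v)) (Φ := fun s => F (x :: s) z)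
        (Φ' := fun s => om x z t * F s z t) (t := t) fun s _ => hasDerivAt_F x s hz ht
      have h3 := hasDerivAt_list_sum (sh (x :: u) v) (Φ := fun s => F (y :: s) z)
        (Φ' := fun s => om y z t * F s z t) (t := t) fun s _ => hasDerivAt_F y s hz ht
      simp only [shs_cons_cons]
      refine (h1.sub (h2.add h3)).congr_deriv ?_
      have e1 := shs_mul (om x z t) (fun s => F s z t) u (y :: v)
      have e2 := shs_mul (om y z t) (fun s => F s z t) (x :: u) v
      rw [shs, ← ih1 t ht] at e1
      rw [shs, ← ih2 t ht] at e2
      rw [e1, e2]; ring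
    obtain ⟨C, hC⟩ := eq_const_of_hasDerivAt_zero hd
    suffices C = 0 by
      intro t ht
      have := hC t ht
      linarith
    by_cases hl : IsLog (x :: u) ∧ IsLog (y :: v)
    · have hlog : ∀ s ∈ sh (x :: u) (y :: v), IsLog s := fun s hs a ha => by
        rcases List.mem_append.1 ((perm_of_mem_sh hs).subset ha) with h | h
        · exact hl.1 a h
        · exact hl.2 a h
      have hne : ∀ s ∈ sh (x :: u) (y :: v), s.length ≠ 0 := fun s hs => by
        rw [(perm_of_mem_sh hs).length_eq]; simp
      have key : ∀ s : List Lt, IsLog s → s.length ≠ 0 → Tendsto (F s z) (𝓝[<] 1) (𝓝 0) := by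
        intro s hs hs'
        have hh : s.headD o ≠ i := by
          cases s with
          | nil => simp
          | cons a s => simp [hs a (by simp)]
        have := tendsto_F_one hh hz
        rwa [F_isLog hs, Real.log_one, zero_pow hs', zero_div] at this
      have h3 := tendsto_list_sum (sh (x :: u) (y :: v)) (Φ := fun s => F s z) (a := fun _ => 0)
        (fun s hs => key s (hlog s hs) (hne s hs))
      have h4 := ((key _ hl.1 (by simp)).mul (key _ hl.2 (by simp))).sub h3
      simp only [List.map_const', List.sum_replicate, smul_zero, mul_zero, sub_zero] at h4
      exact eq_zero_of_tendsto (l := 𝓝[<] 1)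
        (by filter_upwards [Ioo_mem_nhdsLT zero_lt_one] with t ht using hC t ht) h4
    · have hlog : ∀ s ∈ sh (x :: u) (y :: v), ¬ IsLog s := fun s hs h => hl
        ⟨fun a ha => h a ((perm_of_mem_sh hs).symm.subset (List.mem_append_left _ ha)),
          fun a ha => h a ((perm_of_mem_sh hs).symm.subset (List.mem_append_right _ ha))⟩
      have h3 := tendsto_list_sum (sh (x :: u) (y :: v)) (Φ := fun s => F s z) (a := fun _ => 0)
        (l := 𝓝[>] 0) (fun s hs => tendsto_F_zero (hlog s hs) hz)
      have h5 : Tendsto (fun t => F (x :: u) z t * F (y :: v) z t) (𝓝[>] 0) (𝓝 0) := by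
        by_cases hu : IsLog (x :: u)
        · have := tendsto_F_mul_F_zero (u := y :: v) (v := x :: u) (fun h => hl ⟨hu, h⟩) hz
          simpa only [mul_comm] using this
        · exact tendsto_F_mul_F_zero hu hz
      have h4 := h5.sub h3
      simp only [List.map_const', List.sum_replicate, smul_zero, sub_zero] at h4
      exact eq_zero_of_tendsto (l := 𝓝[>] 0)
        (by filter_upwards [Ioo_mem_nhdsGT zero_lt_one] with t ht using hC t ht) h4

theorem F_mul_F_one {u v : List Lt} (hu : u.headD o ≠ i) (hv : v.headD o ≠ i) :
    F u 1 1 * F v 1 1 = shs (fun s => F s 1 1) u v := by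
  have h1 := (tendsto_F_one hu one_pos).mul (tendsto_F_one hv one_pos)
  have h2 := tendsto_list_sum (sh u v) (Φ := fun s => F s 1) (a := fun s => F s 1 1)
    (l := 𝓝[<] 1) (fun s hs => tendsto_F_one (by
      rcases head_of_mem_sh (d := o) hs with h | h
      · rwa [h]
      · rwa [h]) one_pos)
  refine tendsto_nhds_unique h1 (h2.congr' ?_)
  filter_upwards [Ioo_mem_nhdsLT zero_lt_one] with t ht using (F_mul_F one_pos u v t ht).symm

/-- The values of weight `n`. -/
noncomputable def E (n : ℕ) : AddSubgroup ℝ :=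
  AddSubgroup.closure {a | ∃ v : List Lt, v.length = n ∧ M ∉ v ∧ v.headD o ≠ i ∧ a = F v 1 1}

theorem F_mem_E {v : List Lt} (hM : M ∉ v) (hi : v.headD o ≠ i) : F v 1 1 ∈ E v.length :=
  AddSubgroup.subset_closure ⟨v, rfl, hM, hi, rfl⟩

theorem mul_mem_E {p q : ℕ} {a b : ℝ} (ha : a ∈ E p) (hb : b ∈ E q) : a * b ∈ E (p + q) := by
  refine AddSubgroup.closure_induction (p := fun a _ => a * b ∈ E (p + q)) ?_ ?_ ?_ ?_ ha
  · rintro _ ⟨u, rfl, hMu, hu, rfl⟩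
    refine AddSubgroup.closure_induction (p := fun b _ => F u 1 1 * b ∈ E (u.length + q))
      ?_ ?_ ?_ ?_ hb
    · rintro _ ⟨v, rfl, hMv, hv, rfl⟩
      rw [F_mul_F_one hu hv]
      refine shs_mem fun s hs => ?_
      have hp := perm_of_mem_sh hs
      rw [← List.length_append, ← hp.length_eq]
      refine F_mem_E (fun h => ?_) ?_
      · rcases List.mem_append.1 (hp.subset h) with h | h
        · exact hMu h
        · exact hMv h
      · rcases head_of_mem_sh (d := o) hs with h | h
        · rwa [h]
        · rwa [h]
    · simp [(E _).zero_mem]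
    · intro x y _ _ hx hy; rw [mul_add]; exact (E _).add_mem hx hy
    · intro x _ hx; rw [mul_neg]; exact (E _).neg_mem hx
  · simp [(E _).zero_mem]
  · intro x y _ _ hx hy; rw [add_mul]; exact (E _).add_mem hx hy
  · intro x _ hx; rw [neg_mul]; exact (E _).neg_mem hx

/-- Twice the values of weight `n`. -/
noncomputable def E2 (n : ℕ) : AddSubgroup ℝ := (E n).map (AddMonoidHom.mulLeft (2:ℝ))

theorem mem_E2 {n : ℕ} {a : ℝ} : a ∈ E2 n ↔ ∃ b ∈ E n, 2 * b = a := by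
  simp [E2, AddSubgroup.mem_map]

theorem mul_mem_E2 {p q : ℕ} {a b : ℝ} (ha : a ∈ E2 p) (hb : b ∈ E q) : a * b ∈ E2 (p + q) := by
  obtain ⟨c, hc, rfl⟩ := mem_E2.1 ha
  exact mem_E2.2 ⟨c * b, mul_mem_E hc hb, by ring⟩

theorem one_mem_E : (1:ℝ) ∈ E 0 := by
  have := F_mem_E (v := []) (by simp) (by simp)
  simpa [F] using this

/-- Functions that are combinations on `(0,1)` of `e * F v 1` with `Q e v`. -/
def GG (Q : ℝ → List Lt → Prop) : AddSubgroup (ℝ → ℝ) :=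
  AddSubgroup.closure {g | (∀ z ∈ Ioo (0:ℝ) 1, g z = 0) ∨
    ∃ e v, Q e v ∧ ∀ z ∈ Ioo (0:ℝ) 1, g z = e * F v 1 z}

/-- The formal derivatives of elements of `GG Q`. -/
def DD (Q : ℝ → List Lt → Prop) : AddSubgroup (ℝ → ℝ) :=
  AddSubgroup.closure {g | (∀ z ∈ Ioo (0:ℝ) 1, g z = 0) ∨
    ∃ e x v, Q e (x :: v) ∧ ∀ z ∈ Ioo (0:ℝ) 1, g z = e * (om x 1 z * F v 1 z)}

variable {Q Q' : ℝ → List Lt → Prop}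

theorem GG_mono (h : ∀ e v, Q e v → Q' e v) : GG Q ≤ GG Q' := by
  refine AddSubgroup.closure_mono ?_
  rintro g (hg | ⟨e, v, hq, hg⟩)
  · exact Or.inl hg
  · exact Or.inr ⟨e, v, h e v hq, hg⟩

theorem mem_GG {e : ℝ} {v : List Lt} (h : Q e v) {g : ℝ → ℝ}
    (hg : ∀ z ∈ Ioo (0:ℝ) 1, g z = e * F v 1 z) : g ∈ GG Q :=
  AddSubgroup.subset_closure (Or.inr ⟨e, v, h, hg⟩)

theorem GG_congr {f g : ℝ → ℝ} (hf : f ∈ GG Q) (h : ∀ z ∈ Ioo (0:ℝ) 1, g z = f z) : g ∈ GG Q := by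
  have : g - f ∈ GG Q := AddSubgroup.subset_closure (Or.inl fun z hz => by simp [h z hz])
  simpa using (GG Q).add_mem this hf

theorem DD_congr {f g : ℝ → ℝ} (hf : f ∈ DD Q) (h : ∀ z ∈ Ioo (0:ℝ) 1, g z = f z) : g ∈ DD Q := by
  have : g - f ∈ DD Q := AddSubgroup.subset_closure (Or.inl fun z hz => by simp [h z hz])
  simpa using (DD Q).add_mem this hf

theorem om_mul_mem_DD (x : Lt) {h : ℝ → ℝ} (hh : h ∈ GG Q) (hQ : ∀ e v, Q e v → Q' e (x :: v)) :
    (fun z => om x 1 z * h z) ∈ DD Q' := by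
  induction hh using AddSubgroup.closure_induction with
  | mem g hg =>
    rcases hg with hg | ⟨e, v, hq, hg⟩
    · exact AddSubgroup.subset_closure (Or.inl fun z hz => by simp [hg z hz])
    · exact AddSubgroup.subset_closure (Or.inr ⟨e, x, v, hQ e v hq, fun z hz => by
        simp only [hg z hz]; ring⟩)
  | zero => exact AddSubgroup.subset_closure (Or.inl fun z hz => by simp)
  | add f g _ _ hf hg =>
    refine DD_congr ((DD Q').add_mem hf hg) fun z hz => ?_
    simp only [Pi.add_apply]; ring
  | neg f _ hf =>
    refine DD_congr ((DD Q').neg_mem hf) fun z hz => ?_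
    simp only [Pi.neg_apply]; ring

theorem two_mul_mem_GG {h : ℝ → ℝ} (hh : h ∈ GG Q) (hQ : ∀ e v, Q e v → Q' (2 * e) v) :
    (fun z => 2 * h z) ∈ GG Q' := by
  induction hh using AddSubgroup.closure_induction with
  | mem g hg =>
    rcases hg with hg | ⟨e, v, hq, hg⟩
    · exact AddSubgroup.subset_closure (Or.inl fun z hz => by simp [hg z hz])
    · exact mem_GG (hQ e v hq) fun z hz => by rw [hg z hz]; ring
  | zero => exact AddSubgroup.subset_closure (Or.inl fun z hz => by simp)
  | add f g _ _ hf hg =>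
    refine GG_congr ((GG Q').add_mem hf hg) fun z hz => ?_
    simp only [Pi.add_apply]; ring
  | neg f _ hf =>
    refine GG_congr ((GG Q').neg_mem hf) fun z hz => ?_
    simp only [Pi.neg_apply]; ring

theorem exists_primitive {g : ℝ → ℝ} (hg : g ∈ DD Q) :
    ∃ H ∈ GG fun e v => Q e v ∧ v ≠ [], ∀ z ∈ Ioo (0:ℝ) 1, HasDerivAt H (g z) z := by
  induction hg using AddSubgroup.closure_induction with
  | mem g hg =>
    rcases hg with hg | ⟨e, x, v, hq, hg⟩
    · exact ⟨0, AddSubgroup.zero_mem _, fun z hz => by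
        rw [hg z hz]; exact hasDerivAt_const z (0:ℝ)⟩
    · refine ⟨fun z => e * F (x :: v) 1 z, mem_GG ⟨hq, by simp⟩ fun z _ => rfl, fun z hz => ?_⟩
      rw [hg z hz]
      exact (hasDerivAt_F x v zero_lt_one hz).const_mul e
  | zero => exact ⟨0, AddSubgroup.zero_mem _, fun z _ => hasDerivAt_const z (0:ℝ)⟩
  | add f g _ _ hf hg =>
    obtain ⟨H, hH, hf⟩ := hf
    obtain ⟨K, hK, hg⟩ := hg
    exact ⟨H + K, AddSubgroup.add_mem _ hH hK, fun z hz => (hf z hz).add (hg z hz)⟩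
  | neg f _ hf =>
    obtain ⟨H, hH, hf⟩ := hf
    exact ⟨-H, AddSubgroup.neg_mem _ hH, fun z hz => (hf z hz).neg⟩

theorem exists_add_const {f g : ℝ → ℝ} (hg : g ∈ DD Q)
    (hf : ∀ z ∈ Ioo (0:ℝ) 1, HasDerivAt f (g z) z) :
    ∃ H ∈ GG fun e v => Q e v ∧ v ≠ [], ∃ C, ∀ z ∈ Ioo (0:ℝ) 1, f z = H z + C := by
  obtain ⟨H, hH, h⟩ := exists_primitive hg
  obtain ⟨C, hC⟩ := eq_const_of_hasDerivAt_zero (g := fun z => f z - H z) fun z hz =>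
    ((hf z hz).sub (h z hz)).congr_deriv (sub_self _)
  exact ⟨H, hH, C, fun z hz => by linarith [hC z hz]⟩

open Polynomial in
theorem exists_log_expansion (hQ : ∀ e v, Q e v → v ≠ []) {G : ℝ → ℝ} (hG : G ∈ GG Q) :
    ∃ P : ℝ[X], P.coeff 0 = 0 ∧
      Tendsto (fun t => G t - P.eval (Real.log t)) (𝓝[>] 0) (𝓝 0) := by
  have hI : ∀ᶠ t in 𝓝[>] (0:ℝ), t ∈ Ioo (0:ℝ) 1 := Ioo_mem_nhdsGT zero_lt_one
  induction hG using AddSubgroup.closure_induction with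
  | mem g hg =>
    rcases hg with hg | ⟨e, v, hq, hg⟩
    · refine ⟨0, by simp, (tendsto_congr' ?_).1 tendsto_const_nhds⟩
      filter_upwards [hI] with t ht
      simp [hg t ht]
    · by_cases h : IsLog v
      · refine ⟨C (e / (v.length).factorial) * X ^ v.length, ?_, (tendsto_congr' ?_).1 tendsto_const_nhds⟩
        · rw [coeff_C_mul, coeff_X_pow, if_neg, mul_zero]
          exact fun h0 => hQ e v hq (List.length_eq_zero_iff.1 h0.symm)
        · filter_upwards [hI] with t ht
          rw [hg t ht, F_isLog h]
          simp
          ring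
      · refine ⟨0, by simp, (tendsto_congr' ?_).1 (?_ : Tendsto (fun t => e * F v 1 t) _ _)⟩
        · filter_upwards [hI] with t ht
          simp [hg t ht]
        · simpa using (tendsto_F_zero h zero_lt_one).const_mul e
  | zero => exact ⟨0, by simp, by simp⟩
  | add f g _ _ hf hg =>
    obtain ⟨P, hP, hf⟩ := hf
    obtain ⟨R, hR, hg⟩ := hg
    refine ⟨P + R, by simp [hP, hR], ?_⟩
    have := hf.add hg
    rw [add_zero] at this
    refine this.congr fun t => ?_
    simp only [Pi.add_apply, eval_add]; ring
  | neg f _ hf =>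
    obtain ⟨P, hP, hf⟩ := hf
    refine ⟨-P, by simp [hP], ?_⟩
    have := hf.neg
    rw [neg_zero] at this
    refine this.congr fun t => ?_
    simp only [Pi.neg_apply, eval_neg]; ring

open Polynomial in
theorem const_eq_of_tendsto_zero (hQ : ∀ e v, Q e v → v ≠ []) {f G : ℝ → ℝ} (hG : G ∈ GG Q)
    {K L : ℝ} (h : ∀ z ∈ Ioo (0:ℝ) 1, f z = G z + K) (hf : Tendsto f (𝓝[>] 0) (𝓝 L)) : K = L := by
  obtain ⟨P, hP, hl⟩ := exists_log_expansion hQ hG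
  have h1 : Tendsto (fun t => P.eval (Real.log t)) (𝓝[>] 0) (𝓝 (L - K)) := by
    have := (hf.sub_const K).sub hl
    rw [sub_zero] at this
    refine (tendsto_congr' ?_).1 this
    filter_upwards [Ioo_mem_nhdsGT zero_lt_one] with t ht
    rw [h t ht]; ring
  have h2 : Tendsto (fun x => (P.comp (-X)).eval x) atTop (𝓝 (L - K)) := by
    have h3 : Tendsto (fun x : ℝ => Real.exp (-x)) atTop (𝓝[>] 0) :=
      tendsto_nhdsWithin_iff.2 ⟨Real.tendsto_exp_neg_atTop_nhds_zero,
        Eventually.of_forall fun x => Real.exp_pos _⟩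
    refine (h1.comp h3).congr fun x => ?_
    simp
  obtain ⟨h4, h5⟩ := (Polynomial.tendsto_nhds_iff _).1 h2
  have h6 : (P.comp (-X)).leadingCoeff = (P.comp (-X)).eval 0 := by
    rw [eq_C_of_degree_le_zero h5]; simp
  rw [h6, eval_comp] at h4
  simp [← coeff_zero_eq_eval_zero, hP] at h4
  linarith

theorem GG_tendsto_one (hQ : ∀ e v, Q e v → v.headD o ≠ i) {T : AddSubgroup ℝ}
    (hT : ∀ e v, Q e v → e * F v 1 1 ∈ T) {G : ℝ → ℝ} (hG : G ∈ GG Q) :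
    ∃ L ∈ T, Tendsto G (𝓝[<] 1) (𝓝 L) := by
  have hI : ∀ᶠ t in 𝓝[<] (1:ℝ), t ∈ Ioo (0:ℝ) 1 := Ioo_mem_nhdsLT zero_lt_one
  induction hG using AddSubgroup.closure_induction with
  | mem g hg =>
    rcases hg with hg | ⟨e, v, hq, hg⟩
    · refine ⟨0, T.zero_mem, (tendsto_congr' ?_).1 tendsto_const_nhds⟩
      filter_upwards [hI] with t ht
      simp [hg t ht]
    · refine ⟨e * F v 1 1, hT e v hq, (tendsto_congr' ?_).1
        ((tendsto_F_one (hQ e v hq) zero_lt_one).const_mul e)⟩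
      filter_upwards [hI] with t ht
      simp [hg t ht]
  | zero => exact ⟨0, T.zero_mem, tendsto_const_nhds⟩
  | add f g _ _ hf hg =>
    obtain ⟨P, hP, hf⟩ := hf
    obtain ⟨R, hR, hg⟩ := hg
    exact ⟨P + R, T.add_mem hP hR, hf.add hg⟩
  | neg f _ hf =>
    obtain ⟨P, hP, hf⟩ := hf
    exact ⟨-P, T.neg_mem hP, hf.neg⟩

/-- Words satisfying `p` of length at most `n` with coefficients in `A` of complementary weight. -/
def QQ (p : List Lt → Prop) (A : ℕ → AddSubgroup ℝ) (n : ℕ) (e : ℝ) (v : List Lt) : Prop :=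
  p v ∧ v.length ≤ n ∧ e ∈ A (n - v.length)

section
variable {p : List Lt → Prop} {A : ℕ → AddSubgroup ℝ} {n : ℕ}

theorem om_mul_mem_DD_QQ {x : Lt} (hp : ∀ v, p v → p (x :: v)) {h : ℝ → ℝ}
    (hh : h ∈ GG (QQ p A n)) : (fun z => om x 1 z * h z) ∈ DD (QQ p A (n + 1)) :=
  om_mul_mem_DD x hh fun e v ⟨h1, h2, h3⟩ => ⟨hp v h1, by simpa using h2, by simpa using h3⟩

theorem const_mem_GG_QQ (hp : p []) {c : ℝ} (hc : c ∈ A n) {f : ℝ → ℝ}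
    (hf : ∀ z ∈ Ioo (0:ℝ) 1, f z = c) : f ∈ GG (QQ p A n) :=
  mem_GG (e := c) (v := []) ⟨hp, by simp, by simpa using hc⟩ fun z hz => by simp [hf z hz, F]

theorem mem_GG_of_tendsto_zero (hp : p []) {f g : ℝ → ℝ} (hg : g ∈ DD (QQ p A n))
    (hf : ∀ z ∈ Ioo (0:ℝ) 1, HasDerivAt f (g z) z) {L : ℝ} (hL : L ∈ A n)
    (hl : Tendsto f (𝓝[>] 0) (𝓝 L)) : f ∈ GG (QQ p A n) := by
  obtain ⟨H, hH, C, hC⟩ := exists_add_const hg hf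
  have := const_eq_of_tendsto_zero (fun e v h => h.2) hH hC hl
  subst this
  refine GG_congr ((GG _).add_mem (GG_mono (fun e v h => h.1) hH)
    (const_mem_GG_QQ (f := fun _ => C) hp hL fun z _ => rfl)) hC

theorem mem_GG_of_tendsto_one (hp : p []) (hi : ∀ v, p v → v.headD o ≠ i)
    (hA : ∀ e v, QQ p A n e v → e * F v 1 1 ∈ A n) {f g : ℝ → ℝ} (hg : g ∈ DD (QQ p A n))
    (hf : ∀ z ∈ Ioo (0:ℝ) 1, HasDerivAt f (g z) z) {L : ℝ} (hL : L ∈ A n)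
    (hl : Tendsto f (𝓝[<] 1) (𝓝 L)) : f ∈ GG (QQ p A n) := by
  obtain ⟨H, hH, C, hC⟩ := exists_add_const hg hf
  obtain ⟨L', hL', hl'⟩ := GG_tendsto_one (fun e v h => hi v h.1.1) (fun e v h => hA e v h.1) hH
  have : L - L' = C := by
    refine tendsto_nhds_unique (hl.sub hl') ((tendsto_congr' ?_).1 tendsto_const_nhds)
    filter_upwards [Ioo_mem_nhdsLT zero_lt_one] with t ht
    rw [hC t ht]; ring
  subst this
  exact GG_congr ((GG _).add_mem (GG_mono (fun e v h => h.1) hH)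
    (const_mem_GG_QQ (f := fun _ => L - L') hp ((A n).sub_mem hL hL') fun z _ => rfl)) hC

end

theorem F_eq_one_of_not_mem {W : List Lt} (hm : m ∉ W) (hM : M ∉ W) (z t : ℝ) :
    F W z t = F W 1 t := by
  induction W generalizing t with
  | nil => simp [F]
  | cons x W ih =>
    by_cases h : IsLog (x :: W)
    · rw [F_isLog h, F_isLog h]
    · rw [F_cons h, F_cons h]
      simp only [List.mem_cons, not_or] at hm hM
      congr 1
      funext u
      rw [ih hm.2 hM.2]
      cases x <;> simp_all [om, pt]

/-- The words produced by the substitution `z ↦ z ^ 2` from a word in `o` and `i`. -/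
def QS (W : List Lt) (e : ℝ) (v : List Lt) : Prop :=
  v.length = W.length ∧ M ∉ v ∧ (W.headD o ≠ i → v.headD o ≠ i) ∧
    ∃ k : ℤ, e = k ∧ (o ∈ W → Even k)

theorem F_sq_mem {W : List Lt} (hW : ∀ y ∈ W, y = o ∨ y = i) :
    (fun z => F W 1 (z ^ 2)) ∈ GG (QS W) := by
  induction W with
  | nil =>
    have h : QS [] 1 [] := ⟨rfl, by simp, by simp, 1, by simp, by simp⟩
    exact mem_GG h fun z _ => by simp [F]
  | cons x W ih =>
    have ih := ih fun y hy => hW y (by simp [hy])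
    by_cases hl : IsLog (x :: W)
    · refine mem_GG (e := ((2 ^ (W.length + 1) : ℤ) : ℝ)) (v := x :: W)
        ⟨rfl, fun h => by simpa using hl M h, id, _, rfl, fun _ => ?_⟩ fun z hz => ?_
      rotate_left
      · exact Int.even_pow.2 ⟨even_two, by simp⟩
      · rw [F_isLog hl, F_isLog hl, Real.log_pow]
        push_cast
        rw [mul_pow, List.length_cons]; ring
    have hsq : Tendsto (fun z : ℝ => z ^ 2) (𝓝[>] 0) (𝓝[>] 0) := by
      refine tendsto_nhdsWithin_iff.2 ⟨?_, ?_⟩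
      · have : Tendsto (fun z : ℝ => z ^ 2) (𝓝 0) (𝓝 (0 ^ 2)) := tendsto_id.pow 2
        rw [zero_pow two_ne_zero] at this
        exact this.mono_left nhdsWithin_le_nhds
      · filter_upwards [self_mem_nhdsWithin] with z hz
        exact pow_pos (mem_Ioi.1 hz) 2
    have hd : ∀ z ∈ Ioo (0:ℝ) 1, HasDerivAt (fun z => F (x :: W) 1 (z ^ 2))
        (om x 1 (z ^ 2) * F W 1 (z ^ 2) * (2 * z)) z := fun z hz => by
      have hz2 : z ^ 2 ∈ Ioo (0:ℝ) 1 := ⟨pow_pos hz.1 2, pow_lt_one₀ hz.1.le hz.2 two_ne_zero⟩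
      refine (HasDerivAt.comp z (h := fun z : ℝ => z ^ 2)
        (hasDerivAt_F x W one_pos hz2) (hasDerivAt_pow 2 z)).congr_deriv ?_
      simp
    have key : (fun z => om x 1 (z ^ 2) * F W 1 (z ^ 2) * (2 * z)) ∈ DD (QS (x :: W)) := by
      rcases hW x (by simp) with rfl | rfl
      · have h2 : (fun z => 2 * F W 1 (z ^ 2)) ∈ GG (fun e v => ∃ e', e = 2 * e' ∧ QS W e' v) :=
          two_mul_mem_GG ih fun e v hq => ⟨e, rfl, hq⟩
        refine DD_congr (om_mul_mem_DD (Q' := QS (o :: W)) o h2 ?_) fun z hz => ?_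
        · rintro e v ⟨e', rfl, h1, h2, h3, k, rfl, h4⟩
          exact ⟨by simp [h1], by simp [h2], by simp, 2 * k, by push_cast; rfl,
            fun _ => even_two_mul k⟩
        · have := hz.1.ne'
          simp only [om, pt, sub_zero]
          field_simp
      · have h2 : ∀ y, y ≠ M → (fun z => om y 1 z * F W 1 (z ^ 2)) ∈ DD (QS (i :: W)) := by
          intro y hy
          refine om_mul_mem_DD y ih ?_
          rintro e v ⟨h1, h2, h3, k, rfl, h4⟩
          exact ⟨by simp [h1], by simp [h2, hy.symm], by simp, k, rfl, fun h => h4 (by simpa using h)⟩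
        refine DD_congr ((DD _).add_mem (h2 i (by simp)) (h2 m (by simp))) fun z hz => ?_
        have h1 : z - 1 ≠ 0 := by linarith [hz.2]
        have h2 : z + 1 ≠ 0 := by linarith [hz.1]
        have h3 : z ^ 2 - 1 ≠ 0 := by
          have : z ^ 2 - 1 = (z - 1) * (z + 1) := by ring
          rw [this]; exact mul_ne_zero h1 h2
        simp only [om, pt, Pi.add_apply, inv_one, sub_neg_eq_add]
        field_simp
        ring
    obtain ⟨H, hH, C, hC⟩ := exists_add_const key hd
    have h0 := const_eq_of_tendsto_zero (fun e v h => h.2) hH hC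
      ((tendsto_F_zero hl one_pos).comp hsq)
    subst h0
    exact GG_congr (GG_mono (fun e v h => h.1) hH) fun z hz => by rw [hC z hz, add_zero]

theorem F_mem_E2_of_not_mem {W : List Lt} (hW : ∀ y ∈ W, y = o ∨ y = i) (ho : o ∈ W)
    (hi : W.headD o ≠ i) : F W 1 1 ∈ E2 W.length := by
  have hT : ∀ e v, QS W e v → e * F v 1 1 ∈ E2 W.length := by
    rintro e v ⟨h1, h2, h3, k, rfl, h4⟩
    obtain ⟨j, rfl⟩ := h4 ho
    have := (E v.length).zsmul_mem (F_mem_E h2 (h3 hi)) j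
    rw [h1] at this
    refine mem_E2.2 ⟨_, this, ?_⟩
    simp only [zsmul_eq_mul]; push_cast; ring
  obtain ⟨L, hL, hl⟩ := GG_tendsto_one (fun e v h => h.2.2.1 hi) hT (F_sq_mem hW)
  have hsq : Tendsto (fun z : ℝ => z ^ 2) (𝓝[<] 1) (𝓝[<] 1) := by
    refine tendsto_nhdsWithin_iff.2 ⟨?_, ?_⟩
    · have : Tendsto (fun z : ℝ => z ^ 2) (𝓝 1) (𝓝 (1 ^ 2)) := tendsto_id.pow 2
      rw [one_pow] at this
      exact this.mono_left nhdsWithin_le_nhds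
    · filter_upwards [Ioo_mem_nhdsLT zero_lt_one] with z hz
      exact pow_lt_one₀ hz.1.le hz.2 two_ne_zero
  rwa [tendsto_nhds_unique ((tendsto_F_one hi one_pos).comp hsq) hl]

/-- The coefficient groups: integers in weight zero and doubled values in positive weight. -/
noncomputable def RR (k : ℕ) : AddSubgroup ℝ := if k = 0 then E 0 else E2 k

/-- Words in the letters `o` and `m`. -/
def OM (v : List Lt) : Prop := ∀ y ∈ v, y = o ∨ y = m

theorem OM_nil : OM [] := by simp [OM]

theorem OM_cons {x : Lt} {v : List Lt} : OM (x :: v) ↔ (x = o ∨ x = m) ∧ OM v := by simp [OM]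

theorem OM.cons_o {v : List Lt} (h : OM v) : OM (o :: v) := OM_cons.2 ⟨Or.inl rfl, h⟩

theorem OM.cons_m {v : List Lt} (h : OM v) : OM (m :: v) := OM_cons.2 ⟨Or.inr rfl, h⟩

theorem OM.head {v : List Lt} (h : OM v) : v.headD o ≠ i := by
  cases v with
  | nil => simp
  | cons x v => rcases (OM_cons.1 h).1 with rfl | rfl <;> simp

theorem OM.not_mem {v : List Lt} (h : OM v) : M ∉ v := fun hM => by simpa using h M hM

theorem der_mem {T : AddSubgroup (ℝ → ℝ)} {W : List Lt} (hW : ∀ y ∈ W, y ≠ M) {y : Lt}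
    (hy : y ≠ M) {Φ : List Lt → ℝ → ℝ}
    (h : ∀ V, (∀ y ∈ V, y ≠ M) → V.length + 1 = W.length → ∀ a b, a ≠ M → b ≠ M →
      (fun z => kap z a b * Φ V z) ∈ T) :
    (fun z => der (kap z) (fun x => kap z x y) W fun V => Φ V z) ∈ T := by
  induction W generalizing y Φ with
  | nil => exact T.zero_mem
  | cons x W ih =>
    have hx : x ≠ M := hW x (by simp)
    have hW' : ∀ y ∈ W, y ≠ M := fun y hy => hW y (by simp [hy])
    have hh : W.headD o ≠ M := by
      cases W with
      | nil => simp
      | cons a W => simpa using hW' a (by simp)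
    have h1 := h W hW' (by simp) x y hx hy
    have h2 := h W hW' (by simp) x (W.headD o) hx hh
    have h3 := ih hW' hx (Φ := fun V => Φ (x :: V)) fun V hV hl a b ha hb =>
      h (x :: V) (by simpa [hx] using hV) (by simp [hl]) a b ha hb
    have e : (fun z => der (kap z) (fun a => kap z a y) (x :: W) fun V => Φ V z) =
        ((fun z => kap z x y * Φ W z) - (fun z => kap z x (W.headD o) * Φ W z)) +
        fun z => der (kap z) (fun a => kap z a x) W fun V => Φ (x :: V) z := by
      funext z
      simp only [der_cons, Pi.add_apply, Pi.sub_apply]; ring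
    rw [e]
    exact T.add_mem (T.sub_mem h1 h2) h3

theorem kap_m_o {z : ℝ} (hz : z ∈ Ioo (0:ℝ) 1) : kap z m o = - om o 1 z := by
  have := hz.1.ne'
  simp only [kap, dpt, pt, om]; field_simp; ring

theorem kap_m_i {z : ℝ} (hz : z ∈ Ioo (0:ℝ) 1) : kap z m i = om m 1 z - om o 1 z := by
  have := hz.1.ne'
  have h1 : z + 1 ≠ 0 := by linarith [hz.1]
  have h2 : -z⁻¹ - 1 ≠ 0 := by
    have := inv_pos.2 hz.1
    linarith
  have h3 : -1 - z ≠ 0 := by linarith [hz.1]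
  simp only [kap, dpt, pt, om, inv_one, sub_neg_eq_add, sub_zero]
  rw [div_eq_iff h2]
  field_simp
  ring

theorem kap_o_i (z : ℝ) : kap z o i = 0 := by simp [kap, dpt]

theorem kap_mul_mem {A : ℕ → AddSubgroup ℝ} {n : ℕ} {h : ℝ → ℝ} (hh : h ∈ GG (QQ OM A n)) {a b : Lt}
    (ha : a ≠ M) (hb : b ≠ M) : (fun z => kap z a b * h z) ∈ DD (QQ OM A (n + 1)) := by
  have ho := om_mul_mem_DD_QQ (p := OM) (x := o) (fun v hv => hv.cons_o) hh
  have hm := om_mul_mem_DD_QQ (p := OM) (x := m) (fun v hv => hv.cons_m) hh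
  have hmo : (fun z => kap z m o * h z) ∈ DD (QQ OM A (n + 1)) :=
    DD_congr ((DD _).neg_mem ho) fun z hz => by simp [kap_m_o hz]
  have hmi : (fun z => kap z m i * h z) ∈ DD (QQ OM A (n + 1)) :=
    DD_congr ((DD _).sub_mem hm ho) fun z hz => by simp [kap_m_i hz, sub_mul]
  have h0 : (fun z => kap z o i * h z) ∈ DD (QQ OM A (n + 1)) := 
    DD_congr ((DD _).zero_mem) fun z hz => by simp [kap_o_i]
  have hs : ∀ a, (fun z => kap z a a * h z) ∈ DD (QQ OM A (n + 1)) := fun a =>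
    DD_congr ((DD _).zero_mem) fun z hz => by simp [kap_self]
  cases a <;> cases b <;> first | exact hs _ | exact hmo | exact hmi | exact h0 | skip
  all_goals first | exact absurd rfl ha | exact absurd rfl hb | skip
  all_goals simp only [kap_symm _ o m, kap_symm _ i m, kap_symm _ i o]; assumption

/-- Reduction of the letter `i`. -/
theorem K_mem (n : ℕ) {W : List Lt} (hn : W.length = n) (hW : ∀ y ∈ W, y ≠ M)
    (hi : W.headD o ≠ i) : (fun z => F W z 1) ∈ GG (QQ OM RR n) := by
  induction n generalizing W with
  | zero =>
    obtain rfl := List.length_eq_zero_iff.1 hn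
    exact const_mem_GG_QQ OM_nil (c := 1) (by simpa [RR] using one_mem_E) fun z _ => by simp [F]
  | succ n ih =>
    have hM : M ∉ W := fun h => hW M h rfl
    by_cases hm : m ∈ W
    · refine mem_GG_of_tendsto_zero OM_nil (g := fun z => der (kap z) (fun y => kap z y i) W
        fun U => F U z 1) ?_ (fun z hz => hasDerivAt_F_one_z hi hz) (AddSubgroup.zero_mem _)
        (tendsto_F_zero_z hi hm (by rw [List.count_eq_zero_of_not_mem hM]; simp))
      cases W with
      | nil => simp at hn
      | cons x W =>
        have hx : x ≠ M := hW x (by simp)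
        have hx' : x ≠ i := by simpa using hi
        have hW' : ∀ y ∈ W, y ≠ M := fun y hy => hW y (by simp [hy])
        have hl : W.length = n := by simpa using hn
        have h2 : (fun z => der (kap z) (fun a => kap z a x) W fun V => F (x :: V) z 1) ∈
            DD (QQ OM RR (n + 1)) := by
          refine der_mem (Φ := fun V z => F (x :: V) z 1) hW' hx fun V hV hl' a b ha hb => ?_
          exact kap_mul_mem (ih (by simp; omega) (by simpa [hx] using hV) (by simpa using hx')) ha hb
        have h1 : (fun z => (kap z x i - kap z x (W.headD o)) * F W z 1) ∈
            DD (QQ OM RR (n + 1)) := by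
          by_cases hWi : W.headD o = i
          · rw [hWi]
            exact DD_congr ((DD _).zero_mem) fun z hz => by simp
          · have hh : W.headD o ≠ M := by
              cases W with
              | nil => simp
              | cons a W => simpa using hW' a (by simp)
            have hK := ih hl hW' hWi
            exact DD_congr ((DD _).sub_mem (kap_mul_mem hK hx (b := i) (by simp))
              (kap_mul_mem hK hx hh)) fun z hz => by simp only [Pi.sub_apply]; ring
        exact DD_congr ((DD _).add_mem h1 h2) fun z hz => rfl
    · have hoi : ∀ y ∈ W, y = o ∨ y = i := fun y hy => by
        have := hW y hy
        cases y <;> simp_all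
      have ho : o ∈ W := by
        cases W with
        | nil => simp at hn
        | cons x W =>
          rcases hoi x (by simp) with rfl | rfl
          · simp
          · simp at hi
      refine const_mem_GG_QQ OM_nil (c := F W 1 1) ?_ fun z _ => F_eq_one_of_not_mem hm hM z 1
      rw [RR, if_neg (by simp), ← hn]
      exact F_mem_E2_of_not_mem hoi ho hi

/-- The span of the values of words of length `n` in the letters `o` and `m`. -/
noncomputable def EOM (n : ℕ) : AddSubgroup ℝ :=
  AddSubgroup.closure {a | ∃ v : List Lt, v.length = n ∧ OM v ∧ a = F v 1 1}

theorem zero_weight {a : ℝ} (ha : a ∈ E 0) : ∃ k : ℤ, a = k := by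
  induction ha using AddSubgroup.closure_induction with
  | mem x hx =>
    obtain ⟨v, hv, _, _, rfl⟩ := hx
    obtain rfl := List.length_eq_zero_iff.1 hv
    exact ⟨1, by simp [F]⟩
  | zero => exact ⟨0, by simp⟩
  | add x y _ _ hx hy =>
    obtain ⟨k, rfl⟩ := hx
    obtain ⟨l, rfl⟩ := hy
    exact ⟨k + l, by push_cast; rfl⟩
  | neg x _ hx =>
    obtain ⟨k, rfl⟩ := hx
    exact ⟨-k, by push_cast; rfl⟩

theorem E_le_EOM (n : ℕ) : E n ≤ EOM n ⊔ E2 n := by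
  refine (AddSubgroup.closure_le _).2 ?_
  rintro _ ⟨W, hl, hM, hi, rfl⟩
  have hT : ∀ e v, QQ OM RR n e v → e * F v 1 1 ∈ EOM n ⊔ E2 n := by
    rintro e v ⟨h1, h2, h3⟩
    by_cases h0 : n - v.length = 0
    · rw [RR, if_pos h0] at h3
      obtain ⟨k, rfl⟩ := zero_weight h3
      refine (le_sup_left : EOM n ≤ _) ?_
      have : F v 1 1 ∈ EOM n := AddSubgroup.subset_closure ⟨v, by omega, h1, rfl⟩
      simpa using (EOM n).zsmul_mem this k
    · rw [RR, if_neg h0] at h3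
      refine (le_sup_right : E2 n ≤ _) ?_
      have := mul_mem_E2 h3 (F_mem_E h1.not_mem h1.head)
      rwa [Nat.sub_add_cancel h2] at this
  obtain ⟨L, hL, hl⟩ := GG_tendsto_one (fun e v h => h.1.head) hT
    (K_mem n hl (fun y hy h => hM (h ▸ hy)) hi)
  rwa [tendsto_nhds_unique (tendsto_F_one_z hi) hl]

theorem kap_M_o {z : ℝ} (hz : z ∈ Ioo (0:ℝ) 1) : kap z M o = om o 1 z := by
  have := hz.1.ne'
  simp only [kap, dpt, pt, om, sub_zero]; field_simp

theorem kap_M_i {z : ℝ} (hz : z ∈ Ioo (0:ℝ) 1) : kap z M i = om m 1 z := by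
  have h1 : z + 1 ≠ 0 := by linarith [hz.1]
  have h2 : -z - 1 ≠ 0 := by linarith [hz.1]
  simp only [kap, dpt, pt, om, inv_one, sub_neg_eq_add]; field_simp; ring

theorem kap_m_M {z : ℝ} (hz : z ∈ Ioo (0:ℝ) 1) :
    kap z m M = om m 1 z + om i 1 z - om o 1 z := by
  have := hz.1.ne'
  have h1 : z + 1 ≠ 0 := by linarith [hz.1]
  have h2 : z - 1 ≠ 0 := by linarith [hz.2]
  have h3 := pt_ne_pt (x := m) (y := M) (by simp) hz
  simp only [kap, div_eq_iff h3]
  simp only [dpt, pt, om, inv_one, sub_neg_eq_add, sub_zero]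
  field_simp
  ring

theorem der_OM {z : ℝ} (hz : z ∈ Ioo (0:ℝ) 1) {r : List Lt} {q : Lt} (h : OM (r ++ [q]))
    (τ : List Lt) (k : Lt → ℝ) (φ : List Lt → ℝ) : der (kap z) k (r ++ q :: τ) φ =
      (k ((r ++ [q]).headD o) + om o 1 z) * φ (r ++ q :: τ).tail -
      (om o 1 z + kap z q (τ.headD o)) * φ (r ++ τ) +
      der (kap z) (fun y => kap z y q) τ fun V => φ (r ++ q :: V) := by
  induction r generalizing k φ with
  | nil => simp only [List.nil_append, der_cons, List.headD_cons, List.tail_cons]; ring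
  | cons x r ih =>
    rw [List.cons_append, OM_cons] at h
    obtain ⟨y, s, hs⟩ : ∃ y s, r ++ [q] = y :: s := by
      cases r with
      | nil => exact ⟨_, _, rfl⟩
      | cons a r => exact ⟨_, _, rfl⟩
    have hs' : r ++ q :: τ = y :: (s ++ τ) := by
      rw [← List.cons_append, ← hs]; simp
    have hy := (OM_cons.1 (hs ▸ h.2)).1
    rw [List.cons_append, der_cons, ih h.2, hs, hs']
    simp only [List.cons_append, List.headD_cons, List.tail_cons]
    rcases h.1 with rfl | rfl <;> rcases hy with rfl | rfl <;>
      simp only [kap_self, kap_symm z o m, kap_m_o hz] <;> rw [← hs'] <;> ring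

theorem kap_add_om {z : ℝ} (hz : z ∈ Ioo (0:ℝ) 1) {x : Lt} (hx : x = o ∨ x = m) :
    kap z x i + om o 1 z = om x 1 z := by
  rcases hx with rfl | rfl
  · rw [kap_o_i, zero_add]
  · rw [kap_m_i hz, sub_add_cancel]

theorem OM_append {u v : List Lt} : OM (u ++ v) ↔ OM u ∧ OM v := by
  simp only [OM, List.mem_append]
  exact ⟨fun h => ⟨fun y hy => h y (Or.inl hy), fun y hy => h y (Or.inr hy)⟩,
    fun h y hy => hy.elim (h.1 y) (h.2 y)⟩

theorem OM_singleton_o : OM [o] := by simp [OM]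

theorem OM_singleton_m : OM [m] := by simp [OM]

theorem head_append_ne {r τ : List Lt} {q : Lt} (h : OM (r ++ [q])) : (r ++ q :: τ).headD o ≠ i := by
  cases r with
  | nil => simpa using h.head
  | cons a r => simpa using h.head

theorem headD_OM {v : List Lt} (h : OM v) : v.headD o = o ∨ v.headD o = m := by
  cases v with
  | nil => simp
  | cons x v => exact (OM_cons.1 h).1

theorem hasDerivAt_OM {z : ℝ} (hz : z ∈ Ioo (0:ℝ) 1) {r : List Lt} {q : Lt} (h : OM (r ++ [q]))
    (τ : List Lt) : HasDerivAt (fun z => F (r ++ q :: τ) z 1)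
      (om ((r ++ [q]).headD o) 1 z * F (r ++ q :: τ).tail z 1 -
      (om o 1 z + kap z q (τ.headD o)) * F (r ++ τ) z 1 +
      der (kap z) (fun y => kap z y q) τ fun V => F (r ++ q :: V) z 1) z := by
  refine (hasDerivAt_F_one_z (head_append_ne h) hz).congr_deriv ?_
  rw [der_OM hz h, kap_add_om hz (headD_OM h)]

theorem hasDerivAt_o_M {z : ℝ} (hz : z ∈ Ioo (0:ℝ) 1) {r : List Lt} (h : OM r) :
    HasDerivAt (fun z => F (r ++ [o, M]) z 1)
      (om ((r ++ [o]).headD o) 1 z * F (r ++ [o, M]).tail z 1 -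
        2 * (om o 1 z * F (r ++ [M]) z 1)) z := by
  refine (hasDerivAt_OM hz (OM_append.2 ⟨h, OM_singleton_o⟩) [M]).congr_deriv ?_
  simp only [der, List.headD_cons, List.headD_nil, kap_symm z o M, kap_M_o hz]
  ring

theorem hasDerivAt_m_M {z : ℝ} (hz : z ∈ Ioo (0:ℝ) 1) {r : List Lt} (h : OM r) :
    HasDerivAt (fun z => F (r ++ [m, M]) z 1)
      (om ((r ++ [m]).headD o) 1 z * F (r ++ [m, M]).tail z 1 -
        (om m 1 z + om i 1 z) * F (r ++ [M]) z 1 +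
        (om m 1 z + om i 1 z - 2 * om o 1 z) * F (r ++ [m]) z 1) z := by
  refine (hasDerivAt_OM hz (OM_append.2 ⟨h, OM_singleton_m⟩) [M]).congr_deriv ?_
  simp only [der, List.headD_cons, List.headD_nil, kap_symm z M m, kap_M_o hz, kap_m_M hz]
  ring

theorem hasDerivAt_m {z : ℝ} (hz : z ∈ Ioo (0:ℝ) 1) {r : List Lt} (h : OM r) :
    HasDerivAt (fun z => F (r ++ [m]) z 1)
      (om ((r ++ [m]).headD o) 1 z * F (r ++ [m]).tail z 1) z := by
  refine (hasDerivAt_OM hz (OM_append.2 ⟨h, OM_singleton_m⟩) []).congr_deriv ?_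
  simp only [der, List.headD_nil, kap_m_o hz]
  ring

theorem hasDerivAt_M {z : ℝ} (hz : z ∈ Ioo (0:ℝ) 1) :
    HasDerivAt (fun z => F [M] z 1) (om m 1 z - om o 1 z) z := by
  refine (hasDerivAt_F_one_z (W := [M]) (by simp) hz).congr_deriv ?_
  simp only [der, List.headD_nil, kap_M_o hz, kap_M_i hz, F]
  ring

theorem not_isLog_of_mem {W : List Lt} {x : Lt} (hx : x ≠ o) (h : x ∈ W) : ¬ IsLog W :=
  fun hl => hx (hl x h)

theorem F_append_m {u : List Lt} (h : OM u) {z : ℝ} (hz : z ∈ Ioo (0:ℝ) 1) :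
    F (u ++ [m]) z 1 = F (u ++ [m]) 1 z := by
  have h0 : ∀ u : List Lt, OM u → (∀ z ∈ Ioo (0:ℝ) 1,
      HasDerivAt (fun z => F (u ++ [m]) z 1 - F (u ++ [m]) 1 z) 0 z) → ∀ z ∈ Ioo (0:ℝ) 1,
      F (u ++ [m]) z 1 = F (u ++ [m]) 1 z := by
    intro u hu hd z hz
    obtain ⟨C, hC⟩ := eq_const_of_hasDerivAt_zero hd
    have hOM : OM (u ++ [m]) := OM_append.2 ⟨hu, OM_singleton_m⟩
    have h1 := tendsto_F_zero_z hOM.head (by simp)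
      (by rw [List.count_eq_zero_of_not_mem hOM.not_mem]; simp)
    have h2 := tendsto_F_zero (not_isLog_of_mem (x := m) (W := u ++ [m]) (by simp) (by simp)) one_pos
    have h3 := h1.sub h2
    rw [sub_zero] at h3
    have : C = 0 := eq_zero_of_tendsto
      (by filter_upwards [Ioo_mem_nhdsGT zero_lt_one] with t ht using hC t ht) h3
    linarith [hC z hz]
  induction u generalizing z with
  | nil =>
    refine h0 [] h (fun z hz => ?_) z hz
    exact ((hasDerivAt_m hz h).sub (hasDerivAt_F m [] one_pos hz)).congr_deriv (by simp [F])
  | cons x u ih =>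
    refine h0 (x :: u) h (fun z hz => ?_) z hz
    refine ((hasDerivAt_m hz h).sub (hasDerivAt_F x (u ++ [m]) one_pos hz)).congr_deriv ?_
    simp only [List.cons_append, List.headD_cons, List.tail_cons, ih (OM_cons.1 h).2 hz, sub_self]

theorem F_append_M_one (u : List Lt) (t : ℝ) : F (u ++ [M]) 1 t = F (u ++ [m]) 1 t := by
  induction u generalizing t with
  | nil =>
    simp only [List.nil_append]
    rw [F_cons (not_isLog_of_mem (x := M) (by simp) (by simp)),
      F_cons (not_isLog_of_mem (x := m) (by simp) (by simp))]
    simp [om, pt]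
  | cons x u ih =>
    simp only [List.cons_append]
    rw [F_cons (not_isLog_of_mem (x := M) (by simp) (by simp)),
      F_cons (not_isLog_of_mem (x := m) (by simp) (by simp))]
    simp only [ih]

/-- Words without the letter `M`. -/
def NM (v : List Lt) : Prop := M ∉ v

theorem NM_nil : NM [] := by simp [NM]

theorem NM_cons {x : Lt} (hx : x ≠ M) {v : List Lt} (h : NM v) : NM (x :: v) := by
  simp only [NM, List.mem_cons, not_or] at h ⊢
  exact ⟨hx.symm, h⟩

/-- Words without the letter `M` not starting with `i`. -/
def NI (v : List Lt) : Prop := M ∉ v ∧ v.headD o ≠ i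

theorem NI_nil : NI [] := by simp [NI]

theorem NI_cons {x : Lt} (hx : x = o ∨ x = m) {v : List Lt} (h : M ∉ v) : NI (x :: v) := by
  rcases hx with rfl | rfl <;> simp [NI, h]

theorem mul_mem_of_QQ_E {n : ℕ} (e : ℝ) (v : List Lt) (h : QQ NI E n e v) : e * F v 1 1 ∈ E n := by
  have := mul_mem_E h.2.2 (F_mem_E h.1.1 h.1.2)
  rwa [Nat.sub_add_cancel h.2.1] at this

theorem mul_mem_of_QQ_E2 {n : ℕ} (e : ℝ) (v : List Lt) (h : QQ NI E2 n e v) :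
    e * F v 1 1 ∈ E2 n := by
  have := mul_mem_E2 h.2.2 (F_mem_E h.1.1 h.1.2)
  rwa [Nat.sub_add_cancel h.2.1] at this

theorem GG_QQ_mono {p p' : List Lt → Prop} {A : ℕ → AddSubgroup ℝ} {n : ℕ}
    (h : ∀ v, p v → p' v) : GG (QQ p A n) ≤ GG (QQ p' A n) :=
  GG_mono fun _ v hv => ⟨h v hv.1, hv.2⟩

theorem om_mul_mem_NI {A : ℕ → AddSubgroup ℝ} {n : ℕ} {x : Lt} (hx : x = o ∨ x = m) {h : ℝ → ℝ}
    (hh : h ∈ GG (QQ NM A n)) : (fun z => om x 1 z * h z) ∈ DD (QQ NI A (n + 1)) :=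
  om_mul_mem_DD x hh fun e v ⟨h1, h2, h3⟩ =>
    ⟨NI_cons hx h1, by simpa using h2, by simpa using h3⟩

theorem eq_replicate_or_mem {u : List Lt} (h : OM u) : IsLog u ∨ m ∈ u := by
  by_cases hm : m ∈ u
  · exact Or.inr hm
  · exact Or.inl fun y hy => (h y hy).resolve_right fun e => hm (e ▸ hy)

theorem count_append_M {u : List Lt} (h : OM u) : (u ++ [M]).count M ≤ 1 := by
  rw [List.count_append, List.count_eq_zero_of_not_mem h.not_mem]; simp

theorem head_append_M {u : List Lt} (h : OM u) : (u ++ [M]).headD o ≠ i := by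
  cases u with
  | nil => simp
  | cons x u => simpa using h.head

theorem F_append_M_mem_E {u : List Lt} (h : OM u) : F (u ++ [M]) 1 1 ∈ E (u.length + 1) := by
  have hOM : OM (u ++ [m]) := OM_append.2 ⟨h, OM_singleton_m⟩
  rw [F_append_M_one]
  simpa using F_mem_E hOM.not_mem hOM.head

/-- Reduction of a final letter `M`. -/
theorem K_append_M_mem (n : ℕ) {u : List Lt} (hn : u.length = n) (h : OM u) :
    (fun z => F (u ++ [M]) z 1) ∈ GG (QQ NM E (n + 1)) := by
  induction n generalizing u with
  | zero =>
    obtain rfl := List.length_eq_zero_iff.1 hn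
    have hc : (fun _ => (1:ℝ)) ∈ GG (QQ NM E 0) :=
      const_mem_GG_QQ NM_nil one_mem_E fun z _ => rfl
    have hd := (DD _).sub_mem (om_mul_mem_NI (x := m) (Or.inr rfl) hc)
      (om_mul_mem_NI (x := o) (Or.inl rfl) hc)
    have hL := F_append_M_mem_E h
    refine GG_QQ_mono (p := NI) (fun v hv => hv.1) (mem_GG_of_tendsto_one NI_nil
      (fun v hv => hv.2) mul_mem_of_QQ_E hd (fun z hz => ?_) hL
      (tendsto_F_one_z (head_append_M h)))
    exact (hasDerivAt_M hz).congr_deriv (by simp)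
  | succ n ih =>
    rcases List.eq_nil_or_concat' u with rfl | ⟨r, q, rfl⟩
    · simp at hn
    have hr : OM r := (OM_append.1 h).1
    have hq : q = o ∨ q = m := (OM_cons.1 (OM_append.1 h).2).1
    have hl : r.length = n := by simpa using hn
    have hx := headD_OM h
    have htail : (r ++ [q, M]).tail = (r ++ [q]).tail ++ [M] := by cases r <;> simp
    have hOMt : OM (r ++ [q]).tail := fun y hy => h y (List.mem_of_mem_tail hy)
    have h1 := ih (u := (r ++ [q]).tail) (by simp [hl]) hOMt
    have h2 := ih hl hr
    have h3 : (fun z => F (r ++ [m]) z 1) ∈ GG (QQ NM E (n + 1)) := by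
      have hm : OM (r ++ [m]) := OM_append.2 ⟨hr, OM_singleton_m⟩
      refine mem_GG (e := 1) (v := r ++ [m]) ⟨hm.not_mem, by simp [hl], ?_⟩ fun z hz => by
        rw [F_append_m hr hz, one_mul]
      simpa [hl] using one_mem_E
    have ho : ∀ x, x ≠ M → ∀ {h : ℝ → ℝ}, h ∈ GG (QQ NM E (n + 1)) →
        (fun z => om x 1 z * h z) ∈ DD (QQ NM E (n + 1 + 1)) := fun x hx h hh =>
      om_mul_mem_DD_QQ (p := NM) (fun _ => NM_cons hx) hh
    have hxM : (r ++ [q]).headD o ≠ M := by rcases hx with hx | hx <;> rw [hx] <;> decide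
    rcases eq_replicate_or_mem h with hlog | hm
    · obtain rfl : q = o := hlog q (by simp)
      have hd := (DD _).sub_mem (om_mul_mem_NI hx h1)
        ((DD _).add_mem (om_mul_mem_NI (x := o) (by simp) h2) (om_mul_mem_NI (x := o) (by simp) h2))
      have hL := F_append_M_mem_E h
      rw [hn] at hL
      refine GG_QQ_mono (p := NI) (fun v hv => hv.1) (mem_GG_of_tendsto_one NI_nil (fun v hv => hv.2)
        mul_mem_of_QQ_E hd (fun z hz => ?_) hL (tendsto_F_one_z (head_append_M h)))
      have := hasDerivAt_o_M hz hr
      simp only [List.append_assoc, List.cons_append, List.nil_append]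
      refine this.congr_deriv ?_
      simp only [Pi.sub_apply, Pi.add_apply, htail]; ring
    · have hd : (fun z => deriv (fun z => F (r ++ [q] ++ [M]) z 1) z) ∈
          DD (QQ NM E (n + 1 + 1)) := by
        rcases hq with rfl | rfl
        · refine DD_congr ((DD _).sub_mem (ho _ hxM h1)
            ((DD _).add_mem (ho o (by simp) h2) (ho o (by simp) h2))) fun z hz => ?_
          have := (hasDerivAt_o_M hz hr).deriv
          simp only [List.append_assoc, List.cons_append, List.nil_append]
          rw [this]
          simp only [Pi.sub_apply, Pi.add_apply, htail]; ring
        · refine DD_congr ((DD _).add_mem ((DD _).sub_mem (ho _ hxM h1)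
            ((DD _).add_mem (ho m (by simp) h2) (ho i (by simp) h2)))
            ((DD _).sub_mem ((DD _).add_mem (ho m (by simp) h3) (ho i (by simp) h3))
              ((DD _).add_mem (ho o (by simp) h3) (ho o (by simp) h3)))) fun z hz => ?_
          have := (hasDerivAt_m_M hz hr).deriv
          simp only [List.append_assoc, List.cons_append, List.nil_append]
          rw [this]
          simp only [Pi.sub_apply, Pi.add_apply, htail]; ring
      refine mem_GG_of_tendsto_zero NM_nil hd (fun z hz => ?_) (AddSubgroup.zero_mem _)
        (tendsto_F_zero_z (head_append_M h) (List.mem_append_left _ hm) (count_append_M h))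
      have : DifferentiableAt ℝ (fun z => F (r ++ [q] ++ [M]) z 1) z := by
        simpa using (hasDerivAt_OM hz h [M]).differentiableAt
      exact this.hasDerivAt

theorem K_M_eq {z : ℝ} (hz : z ∈ Ioo (0:ℝ) 1) : F [M] z 1 = F [m] 1 z - F [o] 1 z := by
  obtain ⟨C, hC⟩ := eq_const_of_hasDerivAt_zero
    (g := fun z => F [M] z 1 - (F [m] 1 z - F [o] 1 z)) fun z hz =>
    ((hasDerivAt_M hz).sub ((hasDerivAt_F m [] one_pos hz).sub
      (hasDerivAt_F o [] one_pos hz))).congr_deriv (by simp [F])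
  have h1 := (tendsto_F_one_z (W := [M]) (by simp)).sub ((tendsto_F_one (W := [m]) (by simp)
    one_pos).sub (tendsto_F_one (W := [o]) (by simp) one_pos))
  have h2 : F [M] 1 1 - (F [m] 1 1 - F [o] 1 1) = 0 := by
    have := F_append_M_one [] 1
    simp only [List.nil_append] at this
    rw [this, F_isLog (W := [o]) (by simp [IsLog])]; simp
  rw [h2] at h1
  have : C = 0 := eq_zero_of_tendsto
    (by filter_upwards [Ioo_mem_nhdsLT zero_lt_one] with t ht using hC t ht) h1
  linarith [hC z hz]

/-- The differences producing the doubled values. -/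
noncomputable def GV (V : List Lt) (z : ℝ) : ℝ :=
  F (V ++ [o, M]) z 1 - F (V ++ [o, m]) z 1 + F (V ++ [o, o]) 1 z

theorem hasDerivAt_GV_nil {z : ℝ} (hz : z ∈ Ioo (0:ℝ) 1) :
    HasDerivAt (GV []) (-(om o 1 z * (2 * F [M] z 1))) z := by
  have h1 := hasDerivAt_o_M hz OM_nil
  have h2 := hasDerivAt_m (r := [o]) hz OM_singleton_o
  have h3 := hasDerivAt_F o [o] one_pos hz
  refine ((h1.sub h2).add h3).congr_deriv ?_
  have h4 := F_append_m OM_nil hz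
  simp only [List.nil_append, List.cons_append, List.headD_cons, List.tail_cons] at h4 ⊢
  rw [h4, K_M_eq hz]; ring

theorem hasDerivAt_GV_cons {z : ℝ} (hz : z ∈ Ioo (0:ℝ) 1) {x : Lt} {V : List Lt}
    (h : OM (x :: V)) : HasDerivAt (GV (x :: V))
      (om x 1 z * GV V z - om o 1 z * (2 * F (x :: V ++ [M]) z 1)) z := by
  have h1 := hasDerivAt_o_M hz h
  have h2 := hasDerivAt_m (r := x :: V ++ [o]) hz (OM_append.2 ⟨h, OM_singleton_o⟩)
  have h3 := hasDerivAt_F x (V ++ [o, o]) one_pos hz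
  rw [List.append_assoc] at h2
  refine ((h1.sub h2).add h3).congr_deriv ?_
  simp only [List.cons_append, List.nil_append, List.headD_cons, List.tail_cons, GV]
  ring

theorem tendsto_GV_one {V : List Lt} (h : OM V) :
    Tendsto (GV V) (𝓝[<] 1) (𝓝 (F (V ++ [o, o]) 1 1)) := by
  have hoo : OM (V ++ [o, o]) := OM_append.2 ⟨h, OM_singleton_o.cons_o⟩
  have hom : OM (V ++ [o, m]) := OM_append.2 ⟨h, OM_singleton_m.cons_o⟩
  have h1 := ((tendsto_F_one_z (head_append_ne (τ := [M]) (OM_append.2 ⟨h, OM_singleton_o⟩))).sub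
    (tendsto_F_one_z hom.head)).add (tendsto_F_one hoo.head one_pos)
  have h2 := F_append_M_one (V ++ [o]) 1
  simp only [List.append_assoc, List.cons_append, List.nil_append] at h2
  rwa [h2, sub_self, zero_add] at h1

theorem two_mul_K_mem {V : List Lt} (h : OM V) : (fun z => om o 1 z * (2 * F (V ++ [M]) z 1)) ∈
    DD (QQ NI E2 (V.length + 2)) :=
  om_mul_mem_NI (Or.inl rfl) (two_mul_mem_GG (K_append_M_mem _ rfl h) fun e _ hv =>
    ⟨hv.1, hv.2.1, mem_E2.2 ⟨e, hv.2.2, rfl⟩⟩)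

theorem GV_mem {V : List Lt} (h : OM V) : GV V ∈ GG (QQ NI E2 (V.length + 2)) := by
  have hfin : ∀ V : List Lt, OM V → ∀ g ∈ DD (QQ NI E2 (V.length + 2)),
      (∀ z ∈ Ioo (0:ℝ) 1, HasDerivAt (GV V) (g z) z) → GV V ∈ GG (QQ NI E2 (V.length + 2)) := by
    intro V h g hg hd
    rcases eq_replicate_or_mem h with hlog | hm
    · refine mem_GG_of_tendsto_one NI_nil (fun v hv => hv.2) mul_mem_of_QQ_E2 hg hd
        (AddSubgroup.zero_mem _) ?_
      have := tendsto_GV_one h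
      rwa [F_isLog (W := V ++ [o, o]) (by simpa [IsLog, or_imp, forall_and] using hlog), Real.log_one,
        zero_pow (by simp), zero_div] at this
    · have hom : OM (V ++ [o, m]) := OM_append.2 ⟨h, OM_singleton_m.cons_o⟩
      refine mem_GG_of_tendsto_zero NI_nil hg hd (AddSubgroup.zero_mem _) ?_
      have h1 := tendsto_F_zero_z (W := V ++ [o, M])
        (head_append_ne (OM_append.2 ⟨h, OM_singleton_o⟩)) (List.mem_append_left _ hm)
        (by rw [List.count_append, List.count_eq_zero_of_not_mem h.not_mem]; simp)
      have h2 := tendsto_F_zero_z (W := V ++ [o, m]) hom.head (List.mem_append_left _ hm)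
        (by rw [List.count_eq_zero_of_not_mem hom.not_mem]; simp)
      have h3 := tendsto_F_zero (W := V ++ [o, o])
        (not_isLog_of_mem (x := m) (by simp) (List.mem_append_left _ hm)) one_pos
      have := (h1.sub h2).add h3
      rwa [sub_zero, add_zero] at this
  induction V with
  | nil =>
    exact hfin [] h _ ((DD _).neg_mem (two_mul_K_mem OM_nil)) fun z hz => hasDerivAt_GV_nil hz
  | cons x V ih =>
    have hV := OM_cons.1 h
    refine hfin (x :: V) h _ ((DD _).sub_mem (om_mul_mem_NI hV.1
      (GG_QQ_mono (fun v hv => hv.1) (ih hV.2))) (two_mul_K_mem h)) fun z hz => hasDerivAt_GV_cons hz h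

theorem F_append_o_o_mem {V : List Lt} (h : OM V) : F (V ++ [o, o]) 1 1 ∈ E2 (V.length + 2) := by
  obtain ⟨L, hL, hl⟩ := GG_tendsto_one (fun e v h => h.1.2) mul_mem_of_QQ_E2 (GV_mem h)
  rwa [tendsto_nhds_unique (tendsto_GV_one h) hl]

theorem OM_of_mem_sh {u v s : List Lt} (hu : OM u) (hv : OM v) (hs : s ∈ sh u v) : OM s :=
  fun y hy => OM_append.2 ⟨hu, hv⟩ y ((perm_of_mem_sh hs).subset hy)

theorem length_of_mem_sh {u v s : List Lt} (hs : s ∈ sh u v) : s.length = u.length + v.length := by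
  rw [(perm_of_mem_sh hs).length_eq, List.length_append]

theorem F_mem_E_OM {v : List Lt} (h : OM v) : F v 1 1 ∈ E v.length := F_mem_E h.not_mem h.head

theorem shs_o_mem (n : ℕ) {p v : List Lt} (hv : v.length = n) (hp : OM p) (hOM : OM v) :
    shs (fun s => F (p ++ o :: s) 1 1) [o] v ∈ E2 (p.length + v.length + 2) := by
  induction n using Nat.strong_induction_on generalizing p v with
  | _ n ih =>
  have hoo : OM (p ++ [o, o]) := OM_append.2 ⟨hp, OM_singleton_o.cons_o⟩
  have h1 := mul_mem_E2 (F_append_o_o_mem hp) (F_mem_E_OM hOM)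
  rw [F_mul_F_one hoo.head hOM.head, shs_append_cons] at h1
  rw [show p.length + v.length + 2 = p.length + 2 + v.length by omega]
  cases v with
  | nil => simpa [spl, shs_nil_right] using h1
  | cons y v =>
    rw [spl, shs_nil_right] at h1
    refine (AddSubgroup.add_mem_cancel_right _ (spl_mem fun a b hab => shs_mem fun s hs => ?_)).1 h1
    subst hab
    have h2 : OM (y :: a) ∧ OM b := OM_append.1 hOM
    have h3 := ih b.length (by rw [← hv]; simp) rfl (OM_of_mem_sh hp h2.1 hs) h2.2
    rw [length_of_mem_sh hs] at h3
    convert h3 using 2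
    simp only [List.length_cons, List.length_append]
    omega

theorem shs_o_cons (φ : List Lt → ℝ) (v : List Lt) :
    shs φ [o] (m :: v) = φ (o :: m :: v) + shs (fun s => φ (m :: s)) [o] v := by
  rw [shs_cons_cons, shs_nil_left]

/-- The words spanning the values modulo doubled values. -/
def gold : ℕ → List (List Lt)
  | 0 => [[]]
  | 1 => [[m], [o]]
  | n + 2 => (gold (n + 1)).map (m :: ·) ++ (gold n).map fun v => o :: m :: v

theorem shape_o_o {w : List Lt} (h : OM w) :
    (∃ p, o :: o :: w = p ++ [o, o]) ∨ ∃ p v, o :: o :: w = p ++ o :: o :: m :: v := by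
  induction w with
  | nil => exact Or.inl ⟨[], rfl⟩
  | cons x w ih =>
    obtain ⟨rfl | rfl, hw⟩ := OM_cons.1 h
    · rcases ih hw with ⟨p, hp⟩ | ⟨p, v, hp⟩
      · exact Or.inl ⟨o :: p, by rw [hp]; rfl⟩
      · exact Or.inr ⟨o :: p, v, by rw [hp]; rfl⟩
    · exact Or.inr ⟨[], w, rfl⟩

theorem shape (n : ℕ) {w : List Lt} (hn : w.length = n) (h : OM w) :
    (∃ p, w = p ++ [o, o]) ∨ (∃ p v, w = p ++ o :: o :: m :: v) ∨ w ∈ gold n := by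
  induction n using gold.induct generalizing w with
  | case1 => exact Or.inr (Or.inr (by simpa [gold] using hn))
  | case2 =>
    obtain ⟨x, rfl⟩ := List.length_eq_one_iff.1 hn
    right; right
    rcases (OM_cons.1 h).1 with rfl | rfl <;> simp [gold]
  | case3 n ih1 ih2 =>
    match w, hn with
    | x :: y :: w, hn =>
      obtain ⟨hx, hy⟩ := OM_cons.1 h
      have hw := OM_cons.1 hy
      rcases hx with rfl | rfl
      · rcases hw.1 with rfl | rfl
        · rcases shape_o_o hw.2 with h | h
          · exact Or.inl h
          · exact Or.inr (Or.inl h)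
        · rcases ih2 (by simpa using hn) hw.2 with ⟨p, rfl⟩ | ⟨p, v, rfl⟩ | hg
          · exact Or.inl ⟨o :: m :: p, rfl⟩
          · exact Or.inr (Or.inl ⟨o :: m :: p, v, rfl⟩)
          · exact Or.inr (Or.inr (by simp [gold, hg]))
      · rcases ih1 (by simpa using hn) hy with ⟨p, hp⟩ | ⟨p, v, hp⟩ | hg
        · exact Or.inl ⟨m :: p, by rw [hp]; rfl⟩
        · exact Or.inr (Or.inl ⟨m :: p, v, by rw [hp]; rfl⟩)
        · exact Or.inr (Or.inr (by simp [gold, hg]))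

/-- The binary number with digit one for each `o`. -/
def mu : List Lt → ℕ
  | [] => 0
  | x :: v => (if x = o then 2 ^ v.length else 0) + mu v

theorem mu_lt (v : List Lt) : mu v < 2 ^ v.length := by
  induction v with
  | nil => simp [mu]
  | cons x v ih =>
    rw [mu, List.length_cons, pow_succ]
    split_ifs <;> omega

theorem mu_append_lt (p : List Lt) {a b : List Lt} (hl : a.length = b.length) (h : mu a < mu b) :
    mu (p ++ a) < mu (p ++ b) := by
  induction p with
  | nil => exact h
  | cons x p ih =>
    simp only [List.cons_append, mu, List.length_append, hl]
    omega

/-- The generators in weight `n + 1`. -/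
noncomputable def NN (n : ℕ) : AddSubgroup ℝ :=
  AddSubgroup.closure {a | ∃ v ∈ gold n, a = F (m :: v) 1 1}

theorem F_mem_NN (N n : ℕ) {v : List Lt} (hN : mu v = N) (hn : v.length = n + 1) (h : OM v) :
    F v 1 1 ∈ NN n ⊔ E2 (n + 1) := by
  induction N using Nat.strong_induction_on generalizing v with
  | _ N ih =>
  subst hN
  have h1 : ∀ p v', OM p → OM v' → v = p ++ o :: o :: m :: v' →
      F v 1 1 ∈ NN n ⊔ E2 (n + 1) := by
    rintro p v' hp hv' rfl
    have h2 := shs_o_mem _ rfl hp hv'.cons_m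
    rw [shs_o_cons] at h2
    have h3 : p.length + (m :: v').length + 2 = n + 1 := by
      rw [← hn]; simp only [List.length_append, List.length_cons]; omega
    rw [h3] at h2
    refine (AddSubgroup.add_mem_cancel_right _ (shs_mem fun s hs => ?_)).1
      ((le_sup_right : E2 (n + 1) ≤ _) h2)
    have hl := length_of_mem_sh hs
    simp only [List.length_cons, List.length_nil] at hl
    refine ih _ (mu_append_lt p ?_ ?_) rfl ?_ ?_
    · simp [hl]; omega
    · have := mu_lt s
      rw [hl, zero_add, add_comm] at this
      simp only [mu, List.length_cons, hl, reduceCtorEq, if_true, if_false, zero_add]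
      rw [add_comm 1]
      omega
    · rw [← hn]; simp [hl]; omega
    · exact OM_append.2 ⟨hp, (OM_of_mem_sh OM_singleton_o hv' hs).cons_m.cons_o⟩
  have h1' : ∀ p v', v = p ++ o :: o :: m :: v' → F v 1 1 ∈ NN n ⊔ E2 (n + 1) := by
    intro p v' hv
    have := OM_append.1 (hv ▸ h)
    exact h1 p v' this.1 (OM_cons.1 (OM_cons.1 (OM_cons.1 this.2).2).2).2 hv
  have h2 : ∀ p, v = p ++ [o, o] → F v 1 1 ∈ NN n ⊔ E2 (n + 1) := by
    rintro p rfl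
    have h3 := F_append_o_o_mem (OM_append.1 h).1
    simp only [List.length_append, List.length_cons, List.length_nil] at hn
    rw [show p.length + 2 = n + 1 by omega] at h3
    exact (le_sup_right : E2 (n + 1) ≤ _) h3
  cases v with
  | nil => simp at hn
  | cons x v =>
    obtain ⟨rfl | rfl, hv⟩ := OM_cons.1 h
    · cases v with
      | nil =>
        rw [F_isLog (by simp [IsLog])]
        simp
      | cons y v =>
        obtain ⟨rfl | rfl, hv'⟩ := OM_cons.1 hv
        · rcases shape_o_o hv' with ⟨p, hp⟩ | ⟨p, v', hp⟩
          · exact h2 p hp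
          · exact h1' p v' hp
        · have h3 := F_mul_F_one (u := [o]) (v := m :: v) (by simp) (by simp)
          rw [F_isLog (W := [o]) (by simp [IsLog]), shs_o_cons] at h3
          simp only [Real.log_one, List.length_cons, List.length_nil, zero_add, pow_one, zero_div,
            zero_mul] at h3
          rw [eq_neg_of_add_eq_zero_left h3.symm]
          refine AddSubgroup.neg_mem _ (shs_mem fun s hs => ?_)
          have hl := length_of_mem_sh hs
          simp only [List.length_cons, List.length_nil] at hl
          refine ih _ ?_ rfl ?_ (OM_of_mem_sh OM_singleton_o hv' hs).cons_m
          · have := mu_lt s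
            simp [mu]
            have h5 : 2 ^ s.length = 2 ^ (v.length + 1) := by rw [hl]; congr 1; omega
            omega
          · rw [← hn]; simp [hl]; omega
    · rcases shape n (by simpa using hn) hv with ⟨p, rfl⟩ | ⟨p, v', rfl⟩ | hg
      · exact h2 (m :: p) rfl
      · exact h1' (m :: p) v' rfl
      · exact (le_sup_left : NN n ≤ _) (AddSubgroup.subset_closure ⟨v, hg, rfl⟩)

theorem E_le_NN (n : ℕ) : E (n + 1) ≤ NN n ⊔ E2 (n + 1) := by
  refine (E_le_EOM (n + 1)).trans (sup_le ((AddSubgroup.closure_le _).2 ?_) le_sup_right)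
  rintro _ ⟨v, hl, hv, rfl⟩
  exact F_mem_NN _ n rfl hl hv

instance : Finite Lt := Finite.of_surjective
  (fun k : Fin 4 => match k with | 0 => o | 1 => i | 2 => m | 3 => M)
  fun x => by
    cases x
    · exact ⟨0, rfl⟩
    · exact ⟨1, rfl⟩
    · exact ⟨2, rfl⟩
    · exact ⟨3, rfl⟩

theorem E_fg (n : ℕ) : (AddSubgroup.toIntSubmodule (E n)).FG := by
  rw [E, ← Submodule.span_int_eq_addSubgroupClosure]
  refine Submodule.fg_span (Set.Finite.subset ((List.finite_length_eq Lt n).image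
    fun v => F v 1 1) ?_)
  rintro _ ⟨v, hl, _, _, rfl⟩
  exact ⟨v, hl, rfl⟩

theorem mem_span_of_mem_E (n : ℕ) {a : ℝ} (ha : a ∈ E (n + 1)) :
    a ∈ Submodule.span ℚ {a : ℝ | ∃ v ∈ gold n, a = F (m :: v) 1 1} := by
  set N := AddSubgroup.toIntSubmodule (NN n)
  have hle : (AddSubgroup.toIntSubmodule (E (n + 1))).map N.mkQ ≤
      Ideal.span {(2:ℤ)} • (AddSubgroup.toIntSubmodule (E (n + 1))).map N.mkQ := by
    rintro _ ⟨b, hb, rfl⟩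
    obtain ⟨c, hc, d, hd, rfl⟩ := AddSubgroup.mem_sup.1 (E_le_NN n hb)
    obtain ⟨e, he, rfl⟩ := mem_E2.1 hd
    have h0 : N.mkQ c = 0 := by
      rw [Submodule.mkQ_apply, Submodule.Quotient.mk_eq_zero]; exact hc
    have h1 : (2:ℝ) * e = (2:ℤ) • e := by simp
    rw [map_add, h0, zero_add, h1, map_smul]
    exact Submodule.smul_mem_smul (Ideal.mem_span_singleton_self 2) (Submodule.mem_map_of_mem he)
  obtain ⟨r, hr, h⟩ := Submodule.exists_sub_one_mem_and_smul_eq_zero_of_fg_of_le_smul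
    (Ideal.span {(2:ℤ)}) ((AddSubgroup.toIntSubmodule (E (n + 1))).map N.mkQ)
    ((E_fg (n + 1)).map _) hle
  have h1 := h _ (Submodule.mem_map_of_mem (f := N.mkQ) ha)
  rw [← map_smul, Submodule.mkQ_apply, Submodule.Quotient.mk_eq_zero] at h1
  have h2 : r • a ∈ NN n := h1
  have h3 : r ≠ 0 := by
    rintro rfl
    rw [Ideal.mem_span_singleton] at hr
    omega
  have h4 : NN n ≤ (Submodule.span ℚ {a : ℝ | ∃ v ∈ gold n, a = F (m :: v) 1 1}).toAddSubgroup :=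
    (AddSubgroup.closure_le _).2 Submodule.subset_span
  have h5 := Submodule.smul_mem _ ((r : ℚ)⁻¹) (h4 h2)
  rw [← Int.cast_smul_eq_zsmul ℚ, smul_smul, inv_mul_cancel₀ (by exact_mod_cast h3), one_smul] at h5
  exact h5

theorem length_gold (D : ℕ → ℕ) (h0 : D 0 = 1) (h1 : D 1 = 1)
    (hrec : ∀ w, D (w + 2) = D (w + 1) + D w) (n : ℕ) : (gold n).length = D (n + 1) := by
  induction n using gold.induct with
  | case1 => simp [gold, h1]
  | case2 => simp [gold, hrec, h0, h1]
  | case3 n ih1 ih2 => simp [gold, ih1, ih2, hrec (n + 1)]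

/-- The Taylor coefficients of `F W 1` for a word `W` not ending in `o`. -/
noncomputable def cf : List Lt → ℕ → ℝ
  | [], k => if k = 0 then 1 else 0
  | x :: V, k => if x = o then cf V k / k else
      -(pt x 1 ^ k / k * ∑ j ∈ Finset.range k, pt x 1 ^ j * cf V j)

theorem pt_one_sq {x : Lt} (h : x ≠ o) : pt x 1 ^ 2 = 1 := by
  cases x <;> simp_all [pt]

theorem abs_pt_one {x : Lt} (h : x ≠ o) : |pt x 1| = 1 := by
  cases x <;> simp_all [pt]

theorem cf_cons_zero (x : Lt) (V : List Lt) : cf (x :: V) 0 = 0 := by simp [cf]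

theorem cf_cons_succ {x : Lt} (h : x ≠ o) (V : List Lt) (k : ℕ) :
    pt x 1 * (k + 1) * cf (x :: V) (k + 1) = k * cf (x :: V) k - cf V k := by
  have h2 := pt_one_sq h
  simp only [cf, if_neg h, Finset.sum_range_succ]
  push_cast
  have h3 : (pt x 1 ^ k) ^ 2 = 1 := by rw [← pow_mul, mul_comm, pow_mul, h2, one_pow]
  have h4 : ((k:ℝ) + 1) ≠ 0 := by positivity
  rcases Nat.eq_zero_or_pos k with rfl | hk
  · simp
    linear_combination (cf V 0) * h2
  · have h5 : (k:ℝ) ≠ 0 := by positivity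
    field_simp
    rw [pow_succ]
    generalize ∑ j ∈ Finset.range k, pt x 1 ^ j * cf V j = S
    linear_combination -(pt x 1 ^ k * S + (pt x 1 ^ k) ^ 2 * cf V k) * h2 - cf V k * h3

theorem sum_inv_sqrt_le (k : ℕ) : ∑ j ∈ Finset.range k, 1 / √((j:ℝ) + 1) ≤ 2 * √k := by
  induction k with
  | zero => simp
  | succ k ih =>
    rw [Finset.sum_range_succ]
    have h1 : 0 < √((k:ℝ) + 1) := Real.sqrt_pos.2 (by positivity)
    have h2 : √((k:ℝ) + 1) ^ 2 = k + 1 := Real.sq_sqrt (by positivity)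
    have h3 : √(k:ℝ) ^ 2 = k := Real.sq_sqrt (by positivity)
    have h4 : 1 / √((k:ℝ) + 1) ≤ 2 * √((k:ℝ) + 1) - 2 * √k := by
      rw [div_le_iff₀ h1]
      nlinarith [sq_nonneg (√((k:ℝ) + 1) - √(k:ℝ))]
    push_cast
    linarith

theorem exists_abs_cf_le (W : List Lt) : ∃ C, 0 ≤ C ∧ ∀ k, |cf W k| ≤ C * (1 / √((k:ℝ) + 1)) := by
  induction W with
  | nil =>
    refine ⟨1, zero_le_one, fun k => ?_⟩
    rcases Nat.eq_zero_or_pos k with rfl | hk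
    · simp [cf]
    · simp [cf, hk.ne']
  | cons x V ih =>
    obtain ⟨C, hC, h⟩ := ih
    refine ⟨4 * C, by positivity, fun k => ?_⟩
    rcases Nat.eq_zero_or_pos k with rfl | hk
    · simp [cf_cons_zero, hC]
    have hk1 : (1:ℝ) ≤ k := by exact_mod_cast hk
    by_cases hx : x = o
    · simp only [cf, if_pos hx, abs_div, Nat.abs_cast]
      calc |cf V k| / k ≤ |cf V k| := div_le_self (abs_nonneg _) hk1
        _ ≤ _ := (h k).trans (by gcongr; linarith)
    · simp only [cf, if_neg hx, abs_neg, abs_mul, abs_div, abs_pow, abs_pt_one hx, one_pow,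
        Nat.abs_cast]
      have h1 : |∑ j ∈ Finset.range k, pt x 1 ^ j * cf V j| ≤ C * (2 * √k) := by
        refine (Finset.abs_sum_le_sum_abs _ _).trans ?_
        refine le_trans ?_ (mul_le_mul_of_nonneg_left (sum_inv_sqrt_le k) hC)
        rw [Finset.mul_sum]
        refine Finset.sum_le_sum fun j _ => ?_
        rw [abs_mul, abs_pow, abs_pt_one hx, one_pow, one_mul]
        exact h j
      have h2 : 1 / (k:ℝ) * (2 * √k) ≤ 4 * (1 / √((k:ℝ) + 1)) := by
        have h3 : √(k:ℝ) ^ 2 = k := Real.sq_sqrt (by positivity)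
        have h4 : √((k:ℝ) + 1) ^ 2 = k + 1 := Real.sq_sqrt (by positivity)
        have h5 : 0 < √(k:ℝ) := Real.sqrt_pos.2 (by positivity)
        have h6 : 0 < √((k:ℝ) + 1) := Real.sqrt_pos.2 (by positivity)
        have h7 : √((k:ℝ) + 1) ≤ 2 * √(k:ℝ) := by
          rw [Real.sqrt_le_left (by positivity), mul_pow, h3]; linarith
        rw [div_mul_eq_mul_div, one_mul, mul_one_div, div_le_div_iff₀ (by positivity) h6]
        nlinarith
      calc 1 / (k:ℝ) * |∑ j ∈ Finset.range k, pt x 1 ^ j * cf V j|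
          ≤ 1 / (k:ℝ) * (C * (2 * √k)) := by gcongr
        _ = C * (1 / (k:ℝ) * (2 * √k)) := by ring
        _ ≤ C * (4 * (1 / √((k:ℝ) + 1))) := by gcongr
        _ = _ := by ring

theorem exists_abs_cf_le_const (W : List Lt) : ∃ C, ∀ k, |cf W k| ≤ C := by
  obtain ⟨C, hC, h⟩ := exists_abs_cf_le W
  refine ⟨C, fun k => (h k).trans (mul_le_of_le_one_right hC ?_)⟩
  rw [div_le_one (Real.sqrt_pos.2 (by positivity)), Real.one_le_sqrt]
  linarith [Nat.cast_nonneg (α := ℝ) k]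

theorem summable_mul_pow {d : ℕ → ℝ} {C : ℝ} (hd : ∀ k, |d k| ≤ C) {x : ℝ} (hx : |x| < 1) :
    Summable fun k => d k * x ^ k := by
  refine Summable.of_norm_bounded ((summable_geometric_of_lt_one (abs_nonneg x) hx).mul_left C)
    fun k => ?_
  rw [norm_mul, norm_pow]
  exact mul_le_mul_of_nonneg_right (hd k) (by positivity)

theorem summable_deriv_mul_pow {d : ℕ → ℝ} {C : ℝ} (hd : ∀ k, |d k| ≤ C) {x : ℝ} (hx : |x| < 1) :
    Summable fun k : ℕ => (k + 1) * d (k + 1) * x ^ k := by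
  have h := (summable_pow_mul_geometric_of_norm_lt_one 1 (r := |x|) (by simpa using hx)).add
    (summable_geometric_of_lt_one (abs_nonneg x) hx)
  refine Summable.of_norm_bounded (h.mul_left C) fun k => ?_
  rw [norm_mul, norm_pow, norm_mul, Real.norm_of_nonneg (by positivity)]
  calc ((k:ℝ) + 1) * |d (k + 1)| * |x| ^ k ≤ ((k:ℝ) + 1) * C * |x| ^ k := by
        gcongr; exact hd _
    _ = _ := by ring

theorem hasDerivAt_tsum_mul_pow {d : ℕ → ℝ} {C : ℝ} (hd : ∀ k, |d k| ≤ C) {x : ℝ} (hx : |x| < 1) :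
    HasDerivAt (fun x => ∑' k, d k * x ^ k) (∑' k : ℕ, (k + 1) * d (k + 1) * x ^ k) x := by
  obtain ⟨r, hr, hr1⟩ := exists_between hx
  have hr0 : 0 ≤ r := (abs_nonneg x).trans hr.le
  have hC : 0 ≤ C := (abs_nonneg _).trans (hd 0)
  have hu : Summable fun k : ℕ => C * ((k:ℝ) * r ^ (k - 1)) := by
    refine Summable.mul_left C ((summable_nat_add_iff 1).1 ?_)
    have h := (summable_pow_mul_geometric_of_norm_lt_one 1 (r := r)
      (by rwa [Real.norm_of_nonneg hr0])).add (summable_geometric_of_lt_one hr0 hr1)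
    refine h.congr fun k => ?_
    push_cast
    ring
  have h := hasDerivAt_tsum_of_isPreconnected hu (t := Ioo (-r) r) isOpen_Ioo isPreconnected_Ioo
    (g := fun k y => d k * y ^ k) (g' := fun k y => d k * (k * y ^ (k - 1)))
    (fun k y _ => (hasDerivAt_pow k y).const_mul _)
    (fun k y hy => by
      rw [norm_mul, norm_mul, norm_pow, Real.norm_of_nonneg (Nat.cast_nonneg k)]
      have : |y| ≤ r := abs_le.2 ⟨hy.1.le, hy.2.le⟩
      gcongr
      · exact hd k
      · exact this)
    (y₀ := x) (abs_lt.1 hr) (summable_mul_pow hd hx) (abs_lt.1 hr)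
  refine h.congr_deriv ?_
  have hs : Summable fun k : ℕ => d k * (k * x ^ (k - 1)) := by
    refine (summable_nat_add_iff 1).1 ((summable_deriv_mul_pow hd hx).congr fun k => ?_)
    push_cast
    ring
  rw [hs.tsum_eq_zero_add]
  simp only [Nat.cast_zero, zero_mul, mul_zero, zero_add]
  refine tsum_congr fun k => ?_
  push_cast
  ring

/-- Words not ending in `o`. -/
def Gd : List Lt → Prop
  | [] => True
  | x :: V => Gd V ∧ (V = [] → x ≠ o)

theorem Gd.eq_nil {W : List Lt} (h : Gd W) (hL : IsLog W) : W = [] := by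
  induction W with
  | nil => rfl
  | cons x V ih =>
    rw [isLog_cons] at hL
    exact absurd hL.1 (h.2 (ih h.1 hL.2))

theorem sub_pt_mul_tsum (x : Lt) (V : List Lt) (h0 : x = o → cf V 0 = 0) {t : ℝ} (ht : |t| < 1) :
    (t - pt x 1) * ∑' k : ℕ, (k + 1) * cf (x :: V) (k + 1) * t ^ k = ∑' k, cf V k * t ^ k := by
  obtain ⟨C, hC⟩ := exists_abs_cf_le_const (x :: V)
  obtain ⟨C', hC'⟩ := exists_abs_cf_le_const V
  have h1 := summable_deriv_mul_pow hC ht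
  have h2 : Summable fun k : ℕ => (k:ℝ) * cf (x :: V) k * t ^ k := by
    refine (summable_nat_add_iff 1).1 ((h1.mul_left t).congr fun k => ?_)
    push_cast
    ring
  have h3 : t * ∑' k : ℕ, ((k:ℝ) + 1) * cf (x :: V) (k + 1) * t ^ k =
      ∑' k : ℕ, (k:ℝ) * cf (x :: V) k * t ^ k := by
    rw [h2.tsum_eq_zero_add, ← tsum_mul_left]
    simp only [Nat.cast_zero, zero_mul, zero_add]
    refine tsum_congr fun k => ?_
    push_cast
    ring
  rw [sub_mul, h3, ← tsum_mul_left, ← h2.tsum_sub (h1.mul_left _)]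
  refine tsum_congr fun k => ?_
  by_cases hx : x = o
  · subst hx
    have : pt o 1 = 0 := rfl
    rw [this, zero_mul, sub_zero]
    rcases Nat.eq_zero_or_pos k with rfl | hk
    · simp [h0 rfl]
    · have : (k:ℝ) ≠ 0 := by positivity
      simp only [cf, if_true]
      field_simp
  · linear_combination -t ^ k * cf_cons_succ hx V k

theorem Gd.cf_zero {x : Lt} {V : List Lt} (h : Gd (x :: V)) (hx : x = o) : cf V 0 = 0 := by
  cases V with
  | nil => exact absurd hx (h.2 rfl)
  | cons y V => exact cf_cons_zero y V

theorem F_eq_tsum {W : List Lt} (h : Gd W) {t : ℝ} (ht : t ∈ Ioo (0:ℝ) 1) :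
    F W 1 t = ∑' k, cf W k * t ^ k := by
  induction W generalizing t with
  | nil =>
    rw [F_isLog isLog_nil, tsum_eq_single 0]
    · simp [cf]
    · intro k hk
      simp [cf, hk]
  | cons x V ih =>
    obtain ⟨C, hC⟩ := exists_abs_cf_le_const (x :: V)
    have hL : ¬ IsLog (x :: V) := fun hL => by simpa using h.eq_nil hL
    have habs : ∀ y ∈ Ioo (0:ℝ) 1, |y| < 1 := fun y hy => by rw [abs_of_pos hy.1]; exact hy.2
    set g : ℝ → ℝ := fun y => F (x :: V) 1 y - ∑' k, cf (x :: V) k * y ^ k with hg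
    have hd : ∀ y ∈ Ioo (0:ℝ) 1, HasDerivAt g 0 y := by
      intro y hy
      have h1 := (hasDerivAt_F x V zero_lt_one hy).sub (hasDerivAt_tsum_mul_pow hC (habs y hy))
      refine h1.congr_deriv ?_
      rw [sub_eq_zero, ih h.1 hy, ← sub_pt_mul_tsum x V h.cf_zero (habs y hy), om,
        inv_mul_cancel_left₀ (sub_pt_ne zero_lt_one hy)]
    have hT : Tendsto g (𝓝[>] 0) (𝓝 0) := by
      have h1 := (hasDerivAt_tsum_mul_pow hC (x := 0) (by simp)).continuousAt.tendsto.mono_left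
        (nhdsWithin_le_nhds (s := Ioi 0))
      have h2 : ∑' k, cf (x :: V) k * (0:ℝ) ^ k = 0 := by
        rw [tsum_eq_single 0 (fun k hk => by simp [hk])]
        simp [cf_cons_zero]
      rw [h2] at h1
      simpa using (tendsto_F_zero hL zero_lt_one).sub h1
    have hc : ∀ y ∈ Ioo (0:ℝ) 1, g y = g t := fun y hy =>
      (convex_Ioo (0:ℝ) 1).is_const_of_fderivWithin_eq_zero (𝕜 := ℝ)
        (fun y hy => (hd y hy).differentiableAt.differentiableWithinAt)
        (fun y hy => by
          rw [fderivWithin_of_isOpen isOpen_Ioo hy, (hd y hy).hasFDerivAt.fderiv]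
          simp) hy ht
    have h0 : g t = 0 := by
      refine tendsto_nhds_unique (Tendsto.congr' ?_ tendsto_const_nhds) hT
      filter_upwards [Ioo_mem_nhdsGT (zero_lt_one' ℝ)] with y hy
      exact (hc y hy).symm
    exact sub_eq_zero.1 h0

theorem summable_inv_mul_sqrt : Summable fun k : ℕ => 1 / √((k:ℝ) + 1) / (k + 1) := by
  have h := (summable_nat_add_iff 1).2 (Real.summable_one_div_nat_rpow.2
    (by norm_num : (1:ℝ) < 1 + 1 / 2))
  refine h.congr fun k => ?_
  have : (0:ℝ) < k + 1 := by positivity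
  push_cast
  rw [Real.rpow_add this, Real.rpow_one, Real.sqrt_eq_rpow, div_div, mul_comm]

theorem exists_tendsto_sum_cf_o (V : List Lt) :
    ∃ l, Tendsto (fun n => ∑ k ∈ Finset.range n, cf (o :: V) k) atTop (𝓝 l) := by
  obtain ⟨C, hC, h⟩ := exists_abs_cf_le V
  refine ⟨_, (Summable.of_norm_bounded (summable_inv_mul_sqrt.mul_left (2 * C))
    fun k => ?_).hasSum.tendsto_sum_nat⟩
  rcases Nat.eq_zero_or_pos k with rfl | hk
  · simp [cf_cons_zero, hC]
  have hk1 : (1:ℝ) ≤ k := by exact_mod_cast hk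
  have h2 : 0 < √((k:ℝ) + 1) := Real.sqrt_pos.2 (by positivity)
  simp only [cf, if_true, Real.norm_eq_abs, abs_div, Nat.abs_cast]
  rw [div_le_iff₀ (by positivity)]
  refine (h k).trans ?_
  have h1 : 1 ≤ 2 * ((k:ℝ) / (k + 1)) := by
    rw [← mul_div_assoc, le_div_iff₀ (by positivity)]; linarith
  calc C * (1 / √((k:ℝ) + 1)) = C * (1 / √((k:ℝ) + 1)) * 1 := by ring
    _ ≤ C * (1 / √((k:ℝ) + 1)) * (2 * ((k:ℝ) / (k + 1))) := by gcongr
    _ = _ := by ring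

theorem tendsto_cf_zero (W : List Lt) : Tendsto (cf W) atTop (𝓝 0) := by
  obtain ⟨C, hC, h⟩ := exists_abs_cf_le W
  refine squeeze_zero_norm (a := fun k : ℕ => C * (1 / √((k:ℝ) + 1))) h ?_
  have h1 : Tendsto (fun k : ℕ => √((k:ℝ) + 1)) atTop atTop :=
    Real.tendsto_sqrt_atTop.comp (tendsto_atTop_add_const_right _ _ tendsto_natCast_atTop_atTop)
  simpa using h1.inv_tendsto_atTop.const_mul C

theorem exists_tendsto_sum_cf_of_pt {x : Lt} (hp : pt x 1 = -1) (V : List Lt) :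
    ∃ l, Tendsto (fun n => ∑ k ∈ Finset.range n, cf (x :: V) k) atTop (𝓝 l) := by
  obtain ⟨C, hC, h⟩ := exists_abs_cf_le V
  obtain ⟨C', hC', h'⟩ := exists_abs_cf_le (x :: V)
  have hx : x ≠ o := by rintro rfl; simp [pt] at hp
  have hs : Summable fun k => cf (x :: V) k + cf (x :: V) (k + 1) := by
    refine Summable.of_norm_bounded (summable_inv_mul_sqrt.mul_left (C + C')) fun k => ?_
    have h1 := cf_cons_succ hx V k
    have h2 : (0:ℝ) < k + 1 := by positivity
    have h3 : cf (x :: V) k + cf (x :: V) (k + 1) = (cf V k + cf (x :: V) k) / (k + 1) := by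
      rw [hp] at h1
      field_simp
      linear_combination -h1
    rw [h3, norm_div, Real.norm_of_nonneg h2.le, ← mul_div_assoc]
    gcongr
    refine (abs_add_le _ _).trans ?_
    rw [add_mul]
    exact add_le_add (h k) (h' k)
  refine ⟨_, ((hs.hasSum.tendsto_sum_nat.sub (tendsto_cf_zero (x :: V))).div_const 2).congr
    fun n => ?_⟩
  induction n with
  | zero => simp [cf_cons_zero]
  | succ n ih =>
    rw [Finset.sum_range_succ, Finset.sum_range_succ, ← ih]
    ring

theorem tendsto_sum_cf {W : List Lt} (h : Gd W) (hW : W.headD o ≠ i) :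
    Tendsto (fun n => ∑ k ∈ Finset.range n, cf W k) atTop (𝓝 (F W 1 1)) := by
  have hc : ∃ l, Tendsto (fun n => ∑ k ∈ Finset.range n, cf W k) atTop (𝓝 l) := by
    cases W with
    | nil =>
      refine ⟨1, tendsto_const_nhds.congr' ?_⟩
      filter_upwards [eventually_ge_atTop 1] with n hn
      rw [Finset.sum_eq_single 0] <;> simp [cf]
      omega
    | cons x V =>
      cases x
      · exact exists_tendsto_sum_cf_o V
      · exact absurd rfl hW
      · exact exists_tendsto_sum_cf_of_pt (by simp [pt]) V
      · exact exists_tendsto_sum_cf_of_pt (by simp [pt]) V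
  obtain ⟨l, hl⟩ := hc
  have h1 := Real.tendsto_tsum_powerSeries_nhdsWithin_lt hl
  have h2 : F W 1 1 = l := by
    refine tendsto_nhds_unique ((tendsto_F_one hW zero_lt_one).congr' ?_) h1
    filter_upwards [Ioo_mem_nhdsLT (zero_lt_one' ℝ)] with t ht
    exact F_eq_tsum h ht
  rwa [h2]

/-- The letter attached to a sign. -/
noncomputable def lt (e : ℂ) : Lt := by
  classical exact if e = 1 then i else m

/-- The word attached to a list of exponents and signs. -/
noncomputable def wd : ℂ → List (ℕ × ℂ) → List Lt
  | _, [] => []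
  | e, (s, z) :: l => List.replicate (s - 1) o ++ lt (e * z) :: wd (e * z) l

theorem lt_ne_o (e : ℂ) : lt e ≠ o := by
  unfold lt; split_ifs <;> simp

theorem pt_lt {e : ℂ} (he : e ^ 2 = 1) : (pt (lt e) 1 : ℂ) = e := by
  unfold lt
  split_ifs with h
  · simp [pt, h]
  · rcases mul_self_eq_one_iff.1 ((sq e).symm.trans he) with h' | h'
    · exact absurd h' h
    · simp [pt, h']

theorem Gd_replicate {V : List Lt} (n : ℕ) (h : Gd V) (hV : V ≠ []) :
    Gd (List.replicate n o ++ V) := by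
  induction n with
  | zero => exact h
  | succ n ih => exact ⟨ih, fun h' => absurd (List.append_eq_nil_iff.1 h').2 hV⟩

theorem Gd_wd (e : ℂ) (l : List (ℕ × ℂ)) : Gd (wd e l) := by
  induction l generalizing e with
  | nil => trivial
  | cons q l ih => exact Gd_replicate _ ⟨ih _, fun _ => lt_ne_o _⟩ (by simp)

theorem cf_replicate (n : ℕ) (V : List Lt) (k : ℕ) :
    cf (List.replicate n o ++ V) k = cf V k / (k:ℝ) ^ n := by
  induction n with
  | zero => simp
  | succ n ih =>
    rw [List.replicate_succ, List.cons_append, cf, if_pos rfl, ih, div_div, pow_succ]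

theorem sum_cf_wd (l : List (ℕ × ℂ)) {e : ℂ} (he : e ^ 2 = 1)
    (hl : ∀ q ∈ l, 0 < q.1 ∧ q.2 ^ 2 = 1) {n : ℕ} (hn : 1 ≤ n) :
    ∑ k ∈ Finset.range n, e ^ k * (cf (wd e l) k : ℂ) = (-1) ^ l.length * mpvPartial l n := by
  induction l generalizing e n with
  | nil =>
    rw [Finset.sum_eq_single 0]
    · simp [wd, cf, mpvPartial]
    · intro k _ hk
      simp [wd, cf, hk]
    · intro h
      simp at h
      omega
  | cons q l ih =>
    obtain ⟨s, z⟩ := q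
    obtain ⟨hs, hz⟩ := hl (s, z) (by simp)
    simp only at hs hz
    have hez : (e * z) ^ 2 = 1 := by rw [mul_pow, he, hz, one_mul]
    rw [Finset.range_eq_Ico, Finset.sum_eq_sum_Ico_succ_bot (by omega), mpvPartial, Finset.mul_sum]
    have h0 : cf (wd e ((s, z) :: l)) 0 = 0 := by
      rw [wd, cf_replicate, cf_cons_zero, zero_div]
    rw [h0, Complex.ofReal_zero, mul_zero, zero_add, zero_add]
    refine Finset.sum_congr rfl fun k hk => ?_
    rw [Finset.mem_Ico] at hk
    have h1 := ih hez (fun q hq => hl q (List.mem_cons_of_mem _ hq)) hk.1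
    rw [wd, cf_replicate, cf, if_neg (lt_ne_o _)]
    push_cast
    rw [pt_lt hez, h1]
    obtain ⟨s, rfl⟩ : ∃ s', s = s' + 1 := ⟨s - 1, by omega⟩
    have h3 : (e ^ k) ^ 2 = 1 := by rw [← pow_mul, mul_comm, pow_mul, he, one_pow]
    rw [Nat.add_sub_cancel, List.length_cons, mul_pow]
    rw [pow_succ (-1 : ℂ), pow_succ (k : ℂ), div_eq_mul_inv, div_eq_mul_inv, div_eq_mul_inv,
      mul_inv]
    linear_combination
      (-z ^ k * (-1) ^ l.length * mpvPartial l k * (k : ℂ)⁻¹ * ((k : ℂ) ^ s)⁻¹) * h3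

theorem length_wd (e : ℂ) {l : List (ℕ × ℂ)} (hl : ∀ q ∈ l, 0 < q.1) :
    (wd e l).length = (l.map Prod.fst).sum := by
  induction l generalizing e with
  | nil => rfl
  | cons q l ih =>
    have := hl q (by simp)
    simp only [wd, List.length_append, List.length_replicate, List.length_cons, List.map_cons,
      List.sum_cons, ih (e * q.2) fun q hq => hl q (List.mem_cons_of_mem _ hq)]
    omega

theorem M_not_mem_wd (e : ℂ) (l : List (ℕ × ℂ)) : M ∉ wd e l := by
  induction l generalizing e with
  | nil => simp [wd]
  | cons q l ih =>
    have : M ≠ lt (e * q.2) := by unfold lt; split_ifs <;> simp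
    simp [wd, ih, this, List.mem_replicate]

theorem head_wd {l : List (ℕ × ℂ)} (hl : ∀ q ∈ l, 0 < q.1) (h : l.head? ≠ some (1, 1)) :
    (wd 1 l).headD o ≠ i := by
  cases l with
  | nil => simp [wd]
  | cons q l =>
    obtain ⟨s, z⟩ := q
    have hs : 0 < s := hl (s, z) (by simp)
    obtain ⟨s, rfl⟩ : ∃ s', s = s' + 1 := ⟨s - 1, by omega⟩
    rw [wd, Nat.add_sub_cancel]
    cases s with
    | zero =>
      have hz : z ≠ 1 := by rintro rfl; simp at h
      simp [lt, hz]
    | succ s => simp [List.replicate_succ]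

theorem exists_mem_E_of_mem_MPVset {w : ℕ} {x : ℂ} (hx : x ∈ MPVset w 2) :
    ∃ a ∈ E w, (a : ℂ) = x := by
  obtain ⟨l, hl, hw, hh, rfl⟩ := hx
  have hE : F (wd 1 l) 1 1 ∈ E w := by
    rw [← hw, ← length_wd 1 fun q hq => (hl q hq).1]
    exact F_mem_E (M_not_mem_wd 1 l) (head_wd (fun q hq => (hl q hq).1) hh)
  have hT := ((Complex.continuous_ofReal.tendsto _).comp (tendsto_sum_cf (Gd_wd 1 l)
    (head_wd (fun q hq => (hl q hq).1) hh))).const_mul ((-1 : ℂ) ^ l.length)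
  have hLi : Li l = (-1 : ℂ) ^ l.length * (F (wd 1 l) 1 1 : ℂ) := by
    refine (hT.congr' ?_).limUnder_eq
    filter_upwards [eventually_ge_atTop 1] with n hn
    have h1 := sum_cf_wd l (one_pow 2) hl hn
    simp only [one_pow, one_mul] at h1
    rw [Function.comp_apply, Complex.ofReal_sum, h1, ← mul_assoc, ← mul_pow]
    simp
  rcases neg_one_pow_eq_or ℂ l.length with h | h
  · exact ⟨_, hE, by rw [hLi, h, one_mul]⟩
  · exact ⟨_, neg_mem hE, by rw [hLi, h]; simp⟩

end EulerSum

/-- `d(w,2) ≤ D_w` for all `w ≥ 1`, where `D₀ = 1`, `D₁ = 1` and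
`D_w = D_{w−1} + D_{w−2}` for `w ≥ 2`
(so `∑ D_w t^w = (1 − t − t²)⁻¹`); here `d(w,2)` is the dimension of the
`ℚ`-span of the alternating multiple zeta values of weight `w`. -/
theorem mpv_dim_bound_level2 (D : ℕ → ℕ)
    (h0 : D 0 = 1) (h1 : D 1 = 1)
    (hrec : ∀ w, D (w + 2) = D (w + 1) + D w) :
    ∀ w : ℕ, 1 ≤ w → Module.rank ℚ ↥(MPV w 2) ≤ D w := by
  intro w hw
  obtain ⟨n, rfl⟩ : ∃ n, w = n + 1 := ⟨w - 1, by omega⟩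
  let f : ℝ →ₗ[ℚ] ℂ := Complex.ofRealHom.toAddMonoidHom.toRatLinearMap
  let L := EulerSum.gold n
  let S : Set ℂ := Set.range fun k : Fin L.length => f (EulerSum.F (EulerSum.Lt.m :: L.get k) 1 1)
  have hS : MPV (n + 1) 2 ≤ Submodule.span ℚ S := by
    refine Submodule.span_le.2 fun x hx => ?_
    obtain ⟨a, ha, rfl⟩ := EulerSum.exists_mem_E_of_mem_MPVset hx
    have h2 := Submodule.mem_map_of_mem (f := f) (EulerSum.mem_span_of_mem_E n ha)
    rw [Submodule.map_span] at h2
    refine Submodule.span_mono ?_ h2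
    rintro _ ⟨b, ⟨v, hv, rfl⟩, rfl⟩
    obtain ⟨k, rfl⟩ := List.get_of_mem hv
    exact ⟨k, rfl⟩
  calc Module.rank ℚ ↥(MPV (n + 1) 2) ≤ Module.rank ℚ ↥(Submodule.span ℚ S) :=
        Submodule.rank_mono hS
    _ ≤ Cardinal.mk S := rank_span_le S
    _ ≤ Cardinal.mk (Fin L.length) := Cardinal.mk_range_le
    _ = D (n + 1) := by rw [Cardinal.mk_fin, EulerSum.length_gold D h0 h1 hrec n]
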